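/- For every ϵ > 0 and g > 1 there exists a smooth pair (A,B) : ℝ → ℝ² with lim_{x→−∞}(A(x),B(x)) = (1,0), lim_{x→+∞}(A(x),B(x)) = (0,1), and B(x) ≥ 0 for all x ∈ ℝ, such that J_{ϵ,g}(A,B) ≤ J_{ϵ,g}(Ã,B̃) for every pair (Ã,B̃) ∈ X; i.e., the infimum of J_{ϵ,g} over X is attained. -/

import Mathlib

open Filter MeasureTheory
open scoped ENNReal

/-- `P(a,b) = (1/4)(a²+b²−1)² + (1/2)(g−1)a²b²`. -/
noncomputable def Pfun (g a b : ℝ) : ℝ :=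
  (1/4) * (a ^ 2 + b ^ 2 - 1) ^ 2 + (1/2) * (g - 1) * a ^ 2 * b ^ 2

/-- The functional `J_{ϵ,g}(A,B) = ∫_ℝ (ϵ/2)A''² + (1/2)B'² + P(A,B) ∈ [0,∞]`. -/
noncomputable def Jfun (ϵ g : ℝ) (A B : ℝ → ℝ) : ℝ≥0∞ :=
  ∫⁻ x : ℝ, ENNReal.ofReal ((ϵ/2) * (iteratedDeriv 2 A x) ^ 2
    + (1/2) * (deriv B x) ^ 2 + Pfun g (A x) (B x))

/-- The class `X`: `A ∈ C²(ℝ)`, `B ∈ C¹(ℝ)` with heteroclinic limits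
`(1,0)` at `−∞` and `(0,1)` at `+∞`. -/
def memX (A B : ℝ → ℝ) : Prop :=
  ContDiff ℝ 2 A ∧ ContDiff ℝ 1 B ∧
  Tendsto (fun x => (A x, B x)) atBot (nhds ((1 : ℝ), (0 : ℝ))) ∧
  Tendsto (fun x => (A x, B x)) atTop (nhds ((0 : ℝ), (1 : ℝ)))

/-- `F` is a primitive of `f`. -/
def IsPrim (F f : ℝ → ℝ) : Prop :=
  (∀ x y, IntervalIntegrable f volume x y) ∧ ∀ x y, F y - F x = ∫ t in x..y, f t

lemma IsPrim.continuous {F f : ℝ → ℝ} (h : IsPrim F f) : Continuous F := by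
  have h1 : F = fun x => F 0 + ∫ t in (0:ℝ)..x, f t := by
    funext x; rw [← h.2]; ring
  rw [h1]
  exact continuous_const.add (intervalIntegral.continuous_primitive h.1 0)

lemma isPrim_of_hasDerivAt {F f : ℝ → ℝ} (h : ∀ x, HasDerivAt F (f x) x) (hf : Continuous f) :
    IsPrim F f := by
  refine ⟨fun x y => hf.intervalIntegrable x y, fun x y => ?_⟩
  rw [intervalIntegral.integral_eq_sub_of_hasDerivAt (fun t _ => h t) (hf.intervalIntegrable x y)]

lemma isPrim_of_base {F f : ℝ → ℝ} (s : ℝ) (hi : ∀ x y, IntervalIntegrable f volume x y)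
    (h : ∀ x, F x = F s + ∫ t in s..x, f t) : IsPrim F f := by
  refine ⟨hi, fun x y => ?_⟩
  rw [h y, h x, ← intervalIntegral.integral_add_adjacent_intervals (hi x s) (hi s y),
    intervalIntegral.integral_symm s x]
  ring

lemma IsPrim.hasDerivAt {F f : ℝ → ℝ} (h : IsPrim F f) (hf : Continuous f) (x : ℝ) :
    HasDerivAt F (f x) x := by
  have h1 : F = fun x => F 0 + ∫ t in (0:ℝ)..x, f t := by
    funext x; rw [← h.2]; ring
  rw [h1]
  exact (intervalIntegral.integral_hasDerivAt_right (h.1 0 x)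
    (hf.stronglyMeasurableAtFilter _ _) hf.continuousAt).const_add _

lemma IsPrim.congr_ae {F f g : ℝ → ℝ} (h : IsPrim F f) (hfg : f =ᵐ[volume] g) :
    IsPrim F g := by
  refine ⟨fun x y => (h.1 x y).congr_ae (ae_restrict_of_ae hfg), fun x y => ?_⟩
  rw [h.2]
  exact intervalIntegral.integral_congr_ae (hfg.mono fun t ht _ => ht)

lemma IsPrim.add {F f G g : ℝ → ℝ} (h : IsPrim F f) (h' : IsPrim G g) :
    IsPrim (fun x => F x + G x) (fun x => f x + g x) := by
  refine ⟨fun x y => (h.1 x y).add (h'.1 x y), fun x y => ?_⟩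
  rw [intervalIntegral.integral_add (h.1 x y) (h'.1 x y), ← h.2, ← h'.2]; ring

lemma IsPrim.const_mul {F f : ℝ → ℝ} (c : ℝ) (h : IsPrim F f) :
    IsPrim (fun x => c * F x) (fun x => c * f x) := by
  refine ⟨fun x y => (h.1 x y).const_mul c, fun x y => ?_⟩
  rw [intervalIntegral.integral_const_mul, ← h.2]; ring

lemma IsPrim.shift {F f : ℝ → ℝ} (h : IsPrim F f) (s : ℝ) :
    IsPrim (fun x => F (x + s)) (fun x => f (x + s)) := by
  refine ⟨fun x y => ?_, fun x y => ?_⟩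
  · have := (h.1 (x+s) (y+s)).comp_add_right s
    simpa using this
  · rw [intervalIntegral.integral_comp_add_right, ← h.2]

lemma IsPrim.glue {F f G g : ℝ → ℝ} (h : IsPrim F f) (h' : IsPrim G g) (s : ℝ)
    (hs : F s = G s) :
    IsPrim (fun x => if x < s then F x else G x) (fun x => if x < s then f x else g x) := by
  have key : ∀ x y, IntervalIntegrable (fun x => if x < s then f x else g x) volume x y := by
    intro x y
    have h1 := ((h.1 x y).def')
    have h2 := ((h'.1 x y).def')
    rw [intervalIntegrable_iff]
    have : (fun x => if x < s then f x else g x) = (Set.Iio s).piecewise f g := by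
      funext x; simp [Set.piecewise]
    rw [this]
    exact Integrable.piecewise measurableSet_Iio h1.integrableOn h2.integrableOn
  refine isPrim_of_base s key fun x => ?_
  rcases lt_or_ge x s with hx | hx
  · have : ∫ t in s..x, (if t < s then f t else g t) = ∫ t in s..x, f t := by
      rw [intervalIntegral.integral_symm, intervalIntegral.integral_symm x s]
      congr 1
      rw [intervalIntegral.integral_of_le hx.le, intervalIntegral.integral_of_le hx.le]
      rw [integral_Ioc_eq_integral_Ioo, integral_Ioc_eq_integral_Ioo]
      refine setIntegral_congr_fun measurableSet_Ioo fun t ht => ?_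
      simp [ht.2]
    rw [this, ← h.2]; simp [hx, hs]
  · have : ∫ t in s..x, (if t < s then f t else g t) = ∫ t in s..x, g t := by
      refine intervalIntegral.integral_congr fun t ht => ?_
      rw [Set.uIcc_of_le hx] at ht
      simp [not_lt.2 ht.1]
    rw [this, ← h'.2]; simp [not_lt.2 hx]

/-- Admissible paths. -/
structure Pth where
  A : ℝ → ℝ
  A1 : ℝ → ℝ
  f : ℝ → ℝ
  B : ℝ → ℝ
  h : ℝ → ℝ
  mf : Measurable f
  mh : Measurable h
  pA1 : IsPrim A1 f
  pA : IsPrim A A1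
  pB : IsPrim B h

noncomputable def dens (ϵ g : ℝ) (u : Pth) (x : ℝ) : ℝ :=
  (ϵ/2) * (u.f x) ^ 2 + (1/2) * (u.h x) ^ 2 + Pfun g (u.A x) (u.B x)

noncomputable def En (ϵ g : ℝ) (u : Pth) (S : Set ℝ) : ℝ≥0∞ :=
  ∫⁻ x in S, ENNReal.ofReal (dens ϵ g u x)

def phi (u : Pth) (x : ℝ) : ℝ := u.B x ^ 2 - u.A x ^ 2

def inY (u : Pth) : Prop := (∀ᶠ x in atBot, phi u x < 0) ∧ (∀ᶠ x in atTop, 0 < phi u x)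

lemma Pfun_nonneg {g : ℝ} (hg : 1 < g) (a b : ℝ) : 0 ≤ Pfun g a b := by
  unfold Pfun
  have : 0 < g - 1 := by linarith
  positivity

lemma Pfun_cont (g : ℝ) : Continuous (fun p : ℝ × ℝ => Pfun g p.1 p.2) := by
  unfold Pfun; fun_prop

lemma Pth.cA (u : Pth) : Continuous u.A := u.pA.continuous
lemma Pth.cA1 (u : Pth) : Continuous u.A1 := u.pA1.continuous
lemma Pth.cB (u : Pth) : Continuous u.B := u.pB.continuous
lemma phi_cont (u : Pth) : Continuous (phi u) := by
  have := u.cA; have := u.cB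
  unfold phi; fun_prop

lemma PAB_cont (g : ℝ) (u : Pth) : Continuous (fun x => Pfun g (u.A x) (u.B x)) :=
  (Pfun_cont g).comp (u.cA.prodMk u.cB)

lemma dens_meas (ϵ g : ℝ) (u : Pth) : Measurable (dens ϵ g u) := by
  have h1 := u.mf
  have h2 := u.mh
  have h3 := (PAB_cont g u).measurable
  unfold dens
  fun_prop

lemma dens_nonneg {ϵ g : ℝ} (hϵ : 0 < ϵ) (hg : 1 < g) (u : Pth) (x : ℝ) : 0 ≤ dens ϵ g u x := by
  unfold dens
  have := Pfun_nonneg hg (u.A x) (u.B x)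
  positivity

lemma En_mono (ϵ g : ℝ) (u : Pth) {S T : Set ℝ} (h : S ⊆ T) : En ϵ g u S ≤ En ϵ g u T :=
  lintegral_mono_set h

lemma En_split (ϵ g : ℝ) (u : Pth) (s : ℝ) :
    En ϵ g u Set.univ = En ϵ g u (Set.Iio s) + En ϵ g u (Set.Ici s) := by
  unfold En
  rw [← lintegral_add_compl (μ := volume.restrict Set.univ) _ (measurableSet_Iio (a := s))]
  simp

def Pth.shift (u : Pth) (s : ℝ) : Pth where
  A x := u.A (x + s)
  A1 x := u.A1 (x + s)
  f x := u.f (x + s)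
  B x := u.B (x + s)
  h x := u.h (x + s)
  mf := u.mf.comp (measurable_id.add_const s)
  mh := u.mh.comp (measurable_id.add_const s)
  pA1 := u.pA1.shift s
  pA := u.pA.shift s
  pB := u.pB.shift s

lemma En_shift (ϵ g : ℝ) (u : Pth) (s : ℝ) (S : Set ℝ) (hS : MeasurableSet S) :
    En ϵ g (u.shift s) ((fun x => x + s) ⁻¹' S) = En ϵ g u S := by
  unfold En
  rw [← lintegral_indicator hS, ← lintegral_indicator (measurableSet_preimage (measurable_add_const s) hS),
    ← lintegral_add_right_eq_self (μ := volume)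
      (S.indicator (fun x => ENNReal.ofReal (dens ϵ g u x))) s]
  rfl

noncomputable def Pth.glue (u v : Pth) (s : ℝ) (h0 : u.A s = v.A s) (h1 : u.A1 s = v.A1 s)
    (h2 : u.B s = v.B s) : Pth where
  A x := if x < s then u.A x else v.A x
  A1 x := if x < s then u.A1 x else v.A1 x
  f x := if x < s then u.f x else v.f x
  B x := if x < s then u.B x else v.B x
  h x := if x < s then u.h x else v.h x
  mf := Measurable.ite measurableSet_Iio u.mf v.mf
  mh := Measurable.ite measurableSet_Iio u.mh v.mh
  pA1 := u.pA1.glue v.pA1 s h1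
  pA := u.pA.glue v.pA s h0
  pB := u.pB.glue v.pB s h2

lemma dens_glue_lt (ϵ g : ℝ) (u v : Pth) (s : ℝ) (h0 : u.A s = v.A s) (h1 : u.A1 s = v.A1 s)
    (h2 : u.B s = v.B s) {x : ℝ} (hx : x < s) :
    dens ϵ g (u.glue v s h0 h1 h2) x = dens ϵ g u x := by
  simp [dens, Pth.glue, hx]

lemma dens_glue_ge (ϵ g : ℝ) (u v : Pth) (s : ℝ) (h0 : u.A s = v.A s) (h1 : u.A1 s = v.A1 s)
    (h2 : u.B s = v.B s) {x : ℝ} (hx : s ≤ x) :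
    dens ϵ g (u.glue v s h0 h1 h2) x = dens ϵ g v x := by
  simp [dens, Pth.glue, not_lt.2 hx]

lemma En_glue (ϵ g : ℝ) (u v : Pth) (s : ℝ) (h0 : u.A s = v.A s) (h1 : u.A1 s = v.A1 s)
    (h2 : u.B s = v.B s) :
    En ϵ g (u.glue v s h0 h1 h2) Set.univ = En ϵ g u (Set.Iio s) + En ϵ g v (Set.Ici s) := by
  rw [En_split ϵ g _ s]
  unfold En
  congr 1
  · refine setLIntegral_congr_fun measurableSet_Iio fun x hx => ?_
    simp only [dens_glue_lt ϵ g u v s h0 h1 h2 hx]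
  · refine setLIntegral_congr_fun measurableSet_Ici fun x hx => ?_
    simp only [dens_glue_ge ϵ g u v s h0 h1 h2 hx]

noncomputable def cstP (a b : ℝ) : Pth where
  A _ := a
  A1 _ := 0
  f _ := 0
  B _ := b
  h _ := 0
  mf := measurable_const
  mh := measurable_const
  pA1 := isPrim_of_hasDerivAt (fun x => hasDerivAt_const x _) continuous_const
  pA := isPrim_of_hasDerivAt (fun x => hasDerivAt_const x _) continuous_const
  pB := isPrim_of_hasDerivAt (fun x => hasDerivAt_const x _) continuous_const

noncomputable def cubP (σ α β γ s : ℝ) : Pth where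
  A x := σ + α * (3 * (x - (s - 1)) ^ 2 - 2 * (x - (s - 1)) ^ 3)
    + β * ((x - (s - 1)) ^ 3 - (x - (s - 1)) ^ 2)
  A1 x := α * (6 * (x - (s - 1)) - 6 * (x - (s - 1)) ^ 2)
    + β * (3 * (x - (s - 1)) ^ 2 - 2 * (x - (s - 1)))
  f x := α * (6 - 12 * (x - (s - 1))) + β * (6 * (x - (s - 1)) - 2)
  B x := γ * (x - (s - 1))
  h _ := γ
  mf := by fun_prop
  mh := measurable_const
  pA1 := by
    refine isPrim_of_hasDerivAt (fun x => ?_) (by fun_prop)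
    have h1 : HasDerivAt (fun x : ℝ => x - (s - 1)) 1 x := (hasDerivAt_id x).sub_const _
    have := (((h1.const_mul 6).sub ((h1.pow 2).const_mul 6)).const_mul α).add
      ((((h1.pow 2).const_mul 3).sub (h1.const_mul 2)).const_mul β)
    refine HasDerivAt.congr_deriv this ?_
    push_cast; ring
  pA := by
    refine isPrim_of_hasDerivAt (fun x => ?_) (by fun_prop)
    have h1 : HasDerivAt (fun x : ℝ => x - (s - 1)) 1 x := (hasDerivAt_id x).sub_const _
    have := (((((h1.pow 2).const_mul 3).sub ((h1.pow 3).const_mul 2)).const_mul α).const_add σ).add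
      (((h1.pow 3).sub (h1.pow 2)).const_mul β)
    refine HasDerivAt.congr_deriv this ?_
    push_cast; ring
  pB := by
    refine isPrim_of_hasDerivAt (fun x => ?_) (by fun_prop)
    have h1 : HasDerivAt (fun x : ℝ => x - (s - 1)) 1 x := (hasDerivAt_id x).sub_const _
    simpa using h1.const_mul γ

noncomputable def Kb (ϵ g r : ℝ) : ℝ :=
  (ϵ/2) * (10 * r) ^ 2 + (1/2) * r ^ 2 + ((1/4) * (4 * r + 5 * r ^ 2) ^ 2
    + (1/2) * (g - 1) * (1 + 2 * r) ^ 2 * r ^ 2)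

lemma Pfun_bound {g σ p q r : ℝ} (hg : 1 < g) (hσ : σ ^ 2 = 1) (hp : |p| ≤ 2 * r) (hq : |q| ≤ r) :
    Pfun g (σ + p) q ≤ (1/4) * (4 * r + 5 * r ^ 2) ^ 2
    + (1/2) * (g - 1) * (1 + 2 * r) ^ 2 * r ^ 2 := by
  have hσ' : |σ| = 1 := by
    rw [← sq_abs] at hσ
    nlinarith [abs_nonneg σ]
  have h0 := abs_nonneg p
  have h0' := abs_nonneg q
  have h1 : (σ + p) ^ 2 ≤ (1 + 2 * r) ^ 2 := by
    rw [← sq_abs]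
    have := abs_add_le σ p
    gcongr
    linarith
  have h2 : q ^ 2 ≤ r ^ 2 := by rw [← sq_abs]; gcongr
  have h2' : p ^ 2 ≤ (2 * r) ^ 2 := by rw [← sq_abs]; gcongr
  have h3 : ((σ + p) ^ 2 + q ^ 2 - 1) ^ 2 ≤ (4 * r + 5 * r ^ 2) ^ 2 := by
    have e : (σ + p) ^ 2 + q ^ 2 - 1 = 2 * (σ * p) + p ^ 2 + q ^ 2 := by linear_combination hσ
    have hsp : |σ * p| ≤ 2 * r := by rw [abs_mul, hσ', one_mul]; exact hp
    rw [abs_le] at hsp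
    rw [e]
    refine sq_le_sq' ?_ ?_
    · nlinarith
    · nlinarith
  unfold Pfun
  have hg' : 0 ≤ g - 1 := by linarith
  gcongr

lemma cub_bounds {ϵ g σ α β γ s r : ℝ} (hϵ : 0 < ϵ) (hg : 1 < g) (hσ : σ ^ 2 = 1) (hα : |α| ≤ r)
    (hβ : |β| ≤ r) (hγ : |γ| ≤ r) {x : ℝ} (hx : x ∈ Set.Ico (s - 1) s) :
    dens ϵ g (cubP σ α β γ s) x ≤ Kb ϵ g r := by
  obtain ⟨t, ht⟩ : ∃ t, t = x - (s - 1) := ⟨_, rfl⟩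
  have t0 : 0 ≤ t := by rw [ht]; linarith [hx.1]
  have t1 : t ≤ 1 := by rw [ht]; linarith [hx.2]
  have r0 : 0 ≤ r := (abs_nonneg α).trans hα
  have hprod : ∀ c d M : ℝ, |c| ≤ r → |d| ≤ M → |c * d| ≤ r * M := by
    intro c d M h1 h2
    rw [abs_mul]; gcongr
  have hp : |α * (3 * t ^ 2 - 2 * t ^ 3) + β * (t ^ 3 - t ^ 2)| ≤ 2 * r := by
    have q1 : |3 * t ^ 2 - 2 * t ^ 3| ≤ 1 := by
      rw [abs_le]; constructor <;> nlinarith [mul_nonneg t0 t0, mul_nonneg (mul_nonneg t0 t0) (sub_nonneg.2 t1), mul_nonneg (mul_nonneg (sub_nonneg.2 t1) (sub_nonneg.2 t1)) t0, sq_nonneg (1 - t)]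
    have q2 : |t ^ 3 - t ^ 2| ≤ 1 := by
      rw [abs_le]; constructor <;> nlinarith [mul_nonneg t0 t0, mul_nonneg (mul_nonneg t0 t0) (sub_nonneg.2 t1), mul_nonneg t0 (sub_nonneg.2 t1)]
    have := abs_add_le (α * (3 * t ^ 2 - 2 * t ^ 3)) (β * (t ^ 3 - t ^ 2))
    linarith [hprod _ _ _ hα q1, hprod _ _ _ hβ q2]
  have hf : |α * (6 - 12 * t) + β * (6 * t - 2)| ≤ 10 * r := by
    have q1 : |6 - 12 * t| ≤ 6 := by
      rw [abs_le]; constructor <;> nlinarith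
    have q2 : |6 * t - 2| ≤ 4 := by
      rw [abs_le]; constructor <;> nlinarith
    have := abs_add_le (α * (6 - 12 * t)) (β * (6 * t - 2))
    linarith [hprod _ _ _ hα q1, hprod _ _ _ hβ q2]
  have hq : |γ * t| ≤ r := by
    have := hprod γ t 1 hγ (by rw [abs_le]; constructor <;> linarith)
    linarith
  have hP := Pfun_bound hg hσ hp hq
  simp only [dens, cubP, Kb, ← ht, add_assoc] at hP ⊢
  have e1 : (α * (6 - 12 * t) + β * (6 * t - 2)) ^ 2 ≤ (10 * r) ^ 2 := by
    rw [← sq_abs]; gcongr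
  have e2 : γ ^ 2 ≤ r ^ 2 := by rw [← sq_abs]; gcongr
  gcongr

lemma connect {ϵ g σ r : ℝ} (hϵ : 0 < ϵ) (hg : 1 < g) (hσ : σ ^ 2 = 1) (u : Pth) (s : ℝ)
    (hu : ∀ᶠ x in atTop, 0 < phi u x)
    (h0 : |u.A s - σ| ≤ r) (h1 : |u.A1 s| ≤ r) (h2 : |u.B s| ≤ r) :
    ∃ v : Pth, inY v ∧
      En ϵ g v Set.univ ≤ ENNReal.ofReal (Kb ϵ g r) + En ϵ g u (Set.Ici s) := by
  let c := cubP σ (u.A s - σ) (u.A1 s) (u.B s) s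
  let w := (cstP σ 0).glue c (s - 1) (by simp [c, cubP, cstP]) (by simp [c, cubP, cstP])
    (by simp [c, cubP, cstP])
  have hns : ¬ s < s - 1 := by linarith
  let v := w.glue u s (by simp only [w, c, cubP, Pth.glue, hns, if_false]; ring) (by simp only [w, c, cubP, Pth.glue, hns, if_false]; ring)
    (by simp only [w, c, cubP, Pth.glue, hns, if_false]; ring)
  refine ⟨v, ⟨?_, ?_⟩, ?_⟩
  · filter_upwards [eventually_lt_atBot (s - 1)] with x hx
    have hx' : x < s := by linarith
    simp [phi, v, w, Pth.glue, cstP, hx, hx', hσ]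
  · filter_upwards [hu, eventually_ge_atTop s] with x hx hxs
    simpa [phi, v, Pth.glue, not_lt.2 hxs] using hx
  · simp only [v]
    rw [En_glue]
    gcongr
    have hsub : En ϵ g w (Set.Iio s) ≤
        0 + ∫⁻ x in Set.Ico (s-1) s, ENNReal.ofReal (dens ϵ g w x) := by
      have hz : ∫⁻ x in Set.Iio (s-1), ENNReal.ofReal (dens ϵ g w x) = 0 := by
        rw [setLIntegral_congr_fun (g := fun _ => 0) measurableSet_Iio]
        · simp
        · intro x hx
          have e : dens ϵ g w x = dens ϵ g (cstP σ 0) x := dens_glue_lt _ _ _ _ _ _ _ _ hx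
          simp only [e]
          simp [dens, cstP, Pfun, hσ]
      rw [← hz]
      refine le_trans (lintegral_mono_set fun x hx => ?_) (lintegral_union_le _ _ _)
      rcases lt_or_ge x (s-1) with h | h
      · exact Or.inl h
      · exact Or.inr ⟨h, hx⟩
    refine hsub.trans ?_
    rw [zero_add]
    calc _ ≤ ∫⁻ x in Set.Ico (s-1) s, ENNReal.ofReal (Kb ϵ g r) := by
          refine setLIntegral_mono measurable_const fun x hx => ?_
          have e : dens ϵ g w x = dens ϵ g c x := dens_glue_ge _ _ _ _ _ _ _ _ hx.1
          simp only [e]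
          exact ENNReal.ofReal_le_ofReal (cub_bounds hϵ hg hσ h0 h1 h2 hx)
      _ = _ := by simp

lemma exists_finite {ϵ g : ℝ} (hϵ : 0 < ϵ) (hg : 1 < g) :
    ∃ v : Pth, inY v ∧ En ϵ g v Set.univ < ⊤ := by
  obtain ⟨v, hv, hE⟩ := connect (σ := 1) (r := 1) hϵ hg (by norm_num) (cstP 0 1) 0
    (Eventually.of_forall fun x => by simp [phi, cstP])
    (by simp [cstP]) (by simp [cstP]) (by simp [cstP])
  refine ⟨v, hv, hE.trans_lt ?_⟩
  have : En ϵ g (cstP 0 1) (Set.Ici 0) = 0 := by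
    simp [En, dens, cstP, Pfun]
  rw [this]
  simp

lemma weakL2 (f : ℕ → ℝ → ℝ) (hm : ∀ n, MemLp (f n) 2 volume) (C : ℝ)
    (hC : ∀ n, ∫ x, f n x ^ 2 ≤ C) :
    ∃ F : ℝ → ℝ, Measurable F ∧ MemLp F 2 volume ∧ ∃ k : ℕ → ℕ, StrictMono k ∧
      ∀ φ : ℝ → ℝ, MemLp φ 2 volume →
        Tendsto (fun n => ∫ x, f (k n) x * φ x) atTop (nhds (∫ x, F x * φ x)) := by
  let E := Lp ℝ 2 (volume : Measure ℝ)
  have hin : ∀ (a b : ℝ → ℝ) (ha : MemLp a 2 volume) (hb : MemLp b 2 volume),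
      inner ℝ (ha.toLp a) (hb.toLp b) = ∫ x, a x * b x := by
    intro a b ha hb
    rw [L2.inner_def]
    refine integral_congr_ae ?_
    filter_upwards [ha.coeFn_toLp, hb.coeFn_toLp] with x h1 h2
    rw [h1, h2]; simp [mul_comm]
  let y : ℕ → WeakDual ℝ E := fun n => StrongDual.toWeakDual (innerSL ℝ ((hm n).toLp (f n)))
  have hy : ∀ n, y n ∈ WeakDual.toStrongDual ⁻¹' Metric.closedBall (0 : StrongDual ℝ E) (1 + C) := by
    intro n
    simp only [Set.mem_preimage, mem_closedBall_zero_iff]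
    change ‖innerSL ℝ ((hm n).toLp (f n))‖ ≤ _
    rw [innerSL_apply_norm]
    have h2 : ‖(hm n).toLp (f n)‖ ^ 2 ≤ C := by
      rw [← real_inner_self_eq_norm_sq, hin]
      simpa [pow_two] using hC n
    nlinarith [norm_nonneg ((hm n).toLp (f n)), sq_nonneg (‖(hm n).toLp (f n)‖ - 1)]
  have : Fact ((2 : ℝ≥0∞) ≠ ⊤) := ⟨by simp⟩
  have : SecondCountableTopology E := Lp.SecondCountableTopology
  obtain ⟨ψ, -, k, hk, hlim⟩ := WeakDual.isSeqCompact_closedBall ℝ E 0 (1 + C) hy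
  let F0 : E := (InnerProductSpace.toDual ℝ E).symm (WeakDual.toStrongDual ψ)
  have hF0 : ∀ z : E, ψ z = inner ℝ F0 z := by
    intro z
    rw [InnerProductSpace.toDual_symm_apply]; rfl
  refine ⟨F0, (Lp.stronglyMeasurable F0).measurable, Lp.memLp F0, k, hk, fun φ hφ => ?_⟩
  have h1 := (tendsto_iff_forall_eval_tendsto_topDualPairing.1 hlim) (hφ.toLp φ)
  have e1 : ∫ x, F0 x * φ x = ψ (hφ.toLp φ) := by
    rw [hF0, ← hin _ _ (Lp.memLp F0) hφ, Lp.toLp_coeFn]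
  have e2 : ∀ n, ∫ x, f (k n) x * φ x = y (k n) (hφ.toLp φ) := by
    intro n
    rw [← hin _ _ (hm (k n)) hφ]; rfl
  rw [e1]
  simp only [e2]
  exact h1

lemma int_dens {ϵ g : ℝ} (hϵ : 0 < ϵ) (hg : 1 < g) (u : Pth) (hu : En ϵ g u Set.univ < ⊤) :
    Integrable (dens ϵ g u) := by
  refine ⟨(dens_meas ϵ g u).aestronglyMeasurable, ?_⟩
  rw [hasFiniteIntegral_iff_ofReal (Eventually.of_forall (dens_nonneg hϵ hg u))]
  simpa [En] using hu

lemma En_eq {ϵ g : ℝ} (hϵ : 0 < ϵ) (hg : 1 < g) (u : Pth) (hu : En ϵ g u Set.univ < ⊤)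
    (S : Set ℝ) : En ϵ g u S = ENNReal.ofReal (∫ x in S, dens ϵ g u x) := by
  rw [ofReal_integral_eq_lintegral_ofReal (int_dens hϵ hg u hu).integrableOn
    (Eventually.of_forall (dens_nonneg hϵ hg u))]
  rfl

lemma basics {ϵ g C : ℝ} (hϵ : 0 < ϵ) (hg : 1 < g) (hC : 0 ≤ C) (u : Pth)
    (hu : En ϵ g u Set.univ ≤ ENNReal.ofReal C) :
    MemLp u.f 2 volume ∧ MemLp u.h 2 volume ∧ Integrable (fun x => Pfun g (u.A x) (u.B x)) ∧
    (∫ x, u.f x ^ 2) ≤ 2 * C / ϵ ∧ (∫ x, u.h x ^ 2) ≤ 2 * C ∧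
    (∫ x, Pfun g (u.A x) (u.B x)) ≤ C := by
  have hlt : En ϵ g u Set.univ < ⊤ := hu.trans_lt ENNReal.ofReal_lt_top
  have hi := int_dens hϵ hg u hlt
  have hiC : ∫ x, dens ϵ g u x ≤ C := by
    rw [En_eq hϵ hg u hlt, ENNReal.ofReal_le_ofReal_iff hC] at hu
    simpa using hu
  have p1 : ∀ x, u.f x ^ 2 ≤ (2 / ϵ) * dens ϵ g u x := by
    intro x
    have h1 := Pfun_nonneg hg (u.A x) (u.B x)
    have : (2 / ϵ) * dens ϵ g u x = u.f x ^ 2 + (2 / ϵ) * ((1/2) * u.h x ^ 2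
      + Pfun g (u.A x) (u.B x)) := by
      unfold dens; field_simp; ring
    rw [this]
    have : 0 ≤ (2 / ϵ) * ((1/2) * u.h x ^ 2 + Pfun g (u.A x) (u.B x)) := by positivity
    linarith
  have p2 : ∀ x, u.h x ^ 2 ≤ 2 * dens ϵ g u x := by
    intro x
    have h1 := Pfun_nonneg hg (u.A x) (u.B x)
    have : 0 ≤ ϵ * u.f x ^ 2 := by positivity
    unfold dens; linarith
  have p3 : ∀ x, Pfun g (u.A x) (u.B x) ≤ dens ϵ g u x := by
    intro x
    have : 0 ≤ ϵ / 2 * u.f x ^ 2 := by positivity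
    have : 0 ≤ u.h x ^ 2 := by positivity
    unfold dens; linarith
  have i1 : Integrable (fun x => u.f x ^ 2) :=
    (hi.const_mul (2 / ϵ)).mono' (u.mf.pow_const 2).aestronglyMeasurable
      (Eventually.of_forall fun x => by simpa using p1 x)
  have i2 : Integrable (fun x => u.h x ^ 2) :=
    (hi.const_mul 2).mono' (u.mh.pow_const 2).aestronglyMeasurable
      (Eventually.of_forall fun x => by simpa using p2 x)
  have i3 : Integrable (fun x => Pfun g (u.A x) (u.B x)) :=
    hi.mono' (PAB_cont g u).aestronglyMeasurable
      (Eventually.of_forall fun x => by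
        rw [Real.norm_of_nonneg (Pfun_nonneg hg _ _)]; exact p3 x)
  refine ⟨(memLp_two_iff_integrable_sq u.mf.aestronglyMeasurable).2 i1,
    (memLp_two_iff_integrable_sq u.mh.aestronglyMeasurable).2 i2, i3, ?_, ?_, ?_⟩
  · have := integral_mono i1 (hi.const_mul (2 / ϵ)) p1
    rw [integral_const_mul] at this
    refine this.trans ?_
    rw [div_mul_eq_mul_div]
    gcongr
  · have := integral_mono i2 (hi.const_mul 2) p2
    rw [integral_const_mul] at this
    linarith
  · exact (integral_mono i3 hi p3).trans hiC

lemma prim_bound {F f : ℝ → ℝ} {D : ℝ} (h : IsPrim F f) (hf : MemLp f 2 volume)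
    (hD : ∫ x, f x ^ 2 ≤ D) (x : ℝ) : |F x - F 0| ≤ (|x| + D) / 2 := by
  rw [h.2, ← Real.norm_eq_abs]
  have i2 : Integrable (fun x => f x ^ 2) := hf.integrable_sq
  have hJ : ∀ t, ‖f t‖ ≤ (1 + f t ^ 2) / 2 := by
    intro t
    rw [Real.norm_eq_abs, ← sq_abs]
    nlinarith [sq_nonneg (|f t| - 1)]
  have hIntg : IntegrableOn (fun t => (1 + f t ^ 2) / 2) (Set.uIoc 0 x) := by
    refine (Integrable.add ?_ i2.integrableOn).div_const 2
    exact integrableOn_const (by simp [Set.uIoc])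
  calc ‖∫ t in (0:ℝ)..x, f t‖ ≤ ∫ t in Set.uIoc 0 x, ‖f t‖ :=
        intervalIntegral.norm_integral_le_integral_norm_uIoc
    _ ≤ ∫ t in Set.uIoc 0 x, (1 + f t ^ 2) / 2 :=
        integral_mono_of_nonneg (Eventually.of_forall fun t => norm_nonneg _) hIntg
          (Eventually.of_forall hJ)
    _ = (|x| + ∫ t in Set.uIoc 0 x, f t ^ 2) / 2 := by
        have hc : Integrable (fun _ : ℝ => (1:ℝ)) (volume.restrict (Set.uIoc 0 x)) :=
          integrableOn_const (by simp [Set.uIoc])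
        rw [integral_div, integral_add hc i2.integrableOn]
        simp [Set.uIoc, measureReal_def, max_sub_min_eq_abs']
    _ ≤ (|x| + D) / 2 := by
        gcongr
        exact (setIntegral_le_integral i2 (Eventually.of_forall fun t => sq_nonneg _)).trans hD

lemma exists_pt {g C : ℝ} (hg : 1 < g) (u : Pth)
    (hi : Integrable (fun x => Pfun g (u.A x) (u.B x)))
    (hP : (∫ x, Pfun g (u.A x) (u.B x)) ≤ C) (a : ℝ) :
    ∃ t ∈ Set.Icc a (a + 1/3), |u.A t| ≤ 12 * C + 15 ∧ |u.B t| ≤ 12 * C + 15 := by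
  have hC : 0 ≤ C := (integral_nonneg fun x => Pfun_nonneg hg _ _).trans hP
  obtain ⟨t, ht, hlt⟩ : ∃ t ∈ Set.Icc a (a + 1/3), Pfun g (u.A t) (u.B t) ≤ 3 * C + 3 := by
    by_contra! hcon
    have h1 : ∫ x in Set.Icc a (a+1/3), (3 * C + 3) ≤ ∫ x in Set.Icc a (a+1/3),
        Pfun g (u.A x) (u.B x) :=
      setIntegral_mono_on (integrableOn_const (by simp)) hi.integrableOn measurableSet_Icc
        fun x hx => (hcon x hx).le
    have h2 := setIntegral_le_integral (s := Set.Icc a (a+1/3)) hi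
      (Eventually.of_forall fun t => Pfun_nonneg hg _ _)
    have h3 : ∫ x in Set.Icc a (a+1/3), (3 * C + 3) = C + 1 := by
      simp [measureReal_def]; ring
    linarith
  refine ⟨t, ht, ?_⟩
  have h4 : (u.A t ^ 2 + u.B t ^ 2 - 1) ^ 2 ≤ 12 * C + 12 := by
    unfold Pfun at hlt
    have : 0 ≤ (1/2) * (g - 1) * u.A t ^ 2 * u.B t ^ 2 := by
      have : 0 ≤ g - 1 := by linarith
      positivity
    linarith
  have h5 : u.A t ^ 2 + u.B t ^ 2 ≤ 12 * C + 14 := by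
    nlinarith [sq_nonneg (u.A t ^ 2 + u.B t ^ 2 - 2)]
  constructor
  · nlinarith [sq_nonneg (u.B t), sq_nonneg (|u.A t| - 1), sq_abs (u.A t)]
  · nlinarith [sq_nonneg (u.A t), sq_nonneg (|u.B t| - 1), sq_abs (u.B t)]

lemma bdd0 {ϵ g C : ℝ} (hϵ : 0 < ϵ) (hg : 1 < g) (hC : 0 ≤ C) :
    ∃ M, ∀ u : Pth, En ϵ g u Set.univ ≤ ENNReal.ofReal C →
      |u.A 0| ≤ M ∧ |u.A1 0| ≤ M ∧ |u.B 0| ≤ M := by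
  obtain ⟨D1, hD1⟩ : ∃ D1, D1 = (1 + 2 * C / ϵ) / 2 := ⟨_, rfl⟩
  obtain ⟨D2, hD2⟩ : ∃ D2, D2 = (1 + 2 * C) / 2 := ⟨_, rfl⟩
  obtain ⟨N, hN⟩ : ∃ N, N = 12 * C + 15 := ⟨_, rfl⟩
  have hD10 : 0 ≤ D1 := by rw [hD1]; positivity
  have hD20 : 0 ≤ D2 := by rw [hD2]; positivity
  have hN0 : 0 ≤ N := by rw [hN]; positivity
  refine ⟨N + (6 * N + D1 + D1) + D2, fun u hu => ?_⟩
  obtain ⟨m1, m2, i3, b1, b2, b3⟩ := basics hϵ hg hC u hu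
  have hA1 : ∀ x ∈ Set.Icc (0:ℝ) 1, |u.A1 x - u.A1 0| ≤ D1 := by
    intro x hx
    have := prim_bound u.pA1 m1 b1 x
    rw [abs_of_nonneg hx.1] at this
    rw [hD1]; linarith [hx.2]
  have hB : ∀ x ∈ Set.Icc (0:ℝ) 1, |u.B x - u.B 0| ≤ D2 := by
    intro x hx
    have := prim_bound u.pB m2 b2 x
    rw [abs_of_nonneg hx.1] at this
    rw [hD2]; linarith [hx.2]
  obtain ⟨t, ht, htA, htB⟩ := exists_pt hg u i3 b3 0
  obtain ⟨s, hs, hsA, hsB⟩ := exists_pt hg u i3 b3 (2/3)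
  rw [← hN] at htA htB hsA hsB
  have hts : t < s := by linarith [ht.2, hs.1]
  have h1 : |u.A1 0| ≤ 6 * N + D1 := by
    obtain ⟨ξ, hξ, hξ'⟩ := exists_hasDerivAt_eq_slope u.A u.A1 hts u.cA.continuousOn
      (fun x _ => u.pA.hasDerivAt u.cA1 x)
    have e : u.A1 ξ * (s - t) = u.A s - u.A t := by
      rw [hξ']; field_simp [sub_ne_zero.2 hts.ne']
    have e2 : |u.A1 ξ| * (s - t) ≤ 2 * N := by
      rw [← abs_of_pos (sub_pos.2 hts), ← abs_mul, e]
      have := abs_sub (u.A s) (u.A t)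
      linarith
    have e3 : |u.A1 ξ| ≤ 6 * N := by
      nlinarith [abs_nonneg (u.A1 ξ), ht.2, hs.1]
    have e4 := hA1 ξ ⟨by linarith [ht.1, hξ.1], by linarith [hs.2, hξ.2]⟩
    have := abs_sub_abs_le_abs_sub (u.A1 0) (u.A1 ξ)
    rw [abs_sub_comm] at this
    linarith
  have ht01 : t ∈ Set.Icc (0:ℝ) 1 := ⟨ht.1, by linarith [ht.2]⟩
  refine ⟨?_, by linarith, ?_⟩
  · have h2 : |u.A t - u.A 0| ≤ 6 * N + D1 + D1 := by
      rw [u.pA.2]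
      have := intervalIntegral.norm_integral_le_of_norm_le_const (a := 0) (b := t) (f := u.A1)
        (C := 6 * N + D1 + D1) (fun x hx => by
          rw [Set.uIoc_of_le ht.1] at hx
          have e4 := hA1 x ⟨hx.1.le, by linarith [ht01.2, hx.2]⟩
          have := abs_sub_abs_le_abs_sub (u.A1 x) (u.A1 0)
          rw [Real.norm_eq_abs]; linarith)
      rw [Real.norm_eq_abs, sub_zero, abs_of_nonneg ht.1] at this
      refine this.trans ?_
      nlinarith [ht01.2]
    have := abs_sub_abs_le_abs_sub (u.A 0) (u.A t)
    rw [abs_sub_comm] at this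
    linarith
  · have := abs_sub_abs_le_abs_sub (u.B 0) (u.B t)
    rw [abs_sub_comm] at this
    linarith [hB t ht01]

lemma weak_interval {f : ℕ → ℝ → ℝ} {F : ℝ → ℝ}
    (h : ∀ φ : ℝ → ℝ, MemLp φ 2 volume →
        Tendsto (fun n => ∫ x, f n x * φ x) atTop (nhds (∫ x, F x * φ x))) (a b : ℝ) :
    Tendsto (fun n => ∫ x in a..b, f n x) atTop (nhds (∫ x in a..b, F x)) := by
  have key : ∀ a b : ℝ, Tendsto (fun n => ∫ x in Set.Ioc a b, f n x) atTop
      (nhds (∫ x in Set.Ioc a b, F x)) := by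
    intro a b
    have := h ((Set.Ioc a b).indicator 1)
      (memLp_indicator_const 2 measurableSet_Ioc (1:ℝ) (Or.inr (by simp)))
    have e : ∀ q : ℝ → ℝ, ∫ x, q x * (Set.Ioc a b).indicator (1 : ℝ → ℝ) x
        = ∫ x in Set.Ioc a b, q x := by
      intro q
      rw [← integral_indicator measurableSet_Ioc]
      congr 1; funext x
      by_cases hx : x ∈ Set.Ioc a b <;> simp [hx]
    simpa only [e] using this
  simp only [intervalIntegral]
  exact (key a b).sub (key b a)

lemma weak_set {f : ℕ → ℝ → ℝ} {F : ℝ → ℝ} (hF : MemLp F 2 volume)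
    (h : ∀ φ : ℝ → ℝ, MemLp φ 2 volume →
        Tendsto (fun n => ∫ x, f n x * φ x) atTop (nhds (∫ x, F x * φ x)))
    {S : Set ℝ} (hS : MeasurableSet S) :
    Tendsto (fun n => ∫ x in S, f n x * F x) atTop (nhds (∫ x in S, F x ^ 2)) := by
  have := h (S.indicator F) (hF.indicator hS)
  have e : ∀ q : ℝ → ℝ, ∫ x, q x * S.indicator F x = ∫ x in S, q x * F x := by
    intro q
    rw [← integral_indicator hS]
    congr 1; funext x
    by_cases hx : x ∈ S <;> simp [hx]
  simp only [e] at this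
  simpa only [pow_two] using this

lemma sq_ineq {f F : ℝ → ℝ} (hf : MemLp f 2 volume) (hF : MemLp F 2 volume) (S : Set ℝ) :
    2 * (∫ x in S, f x * F x) - ∫ x in S, F x ^ 2 ≤ ∫ x in S, f x ^ 2 := by
  have i1 : IntegrableOn (fun x => f x * F x) S := (hf.integrable_mul hF).integrableOn
  have i2 : IntegrableOn (fun x => F x ^ 2) S := hF.integrable_sq.integrableOn
  have i3 : IntegrableOn (fun x => f x ^ 2) S := hf.integrable_sq.integrableOn
  rw [← integral_const_mul, ← integral_sub (i1.const_mul 2) i2]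
  refine integral_mono ((i1.const_mul 2).sub i2) i3 fun x => ?_
  simp only
  nlinarith [sq_nonneg (f x - F x)]

lemma En_decomp {ϵ g : ℝ} (hϵ : 0 < ϵ) (hg : 1 < g) (u : Pth) (m1 : MemLp u.f 2 volume)
    (m2 : MemLp u.h 2 volume) (S : Set ℝ) :
    En ϵ g u S = ENNReal.ofReal ((ϵ/2) * (∫ x in S, u.f x ^ 2) + (1/2) * (∫ x in S, u.h x ^ 2))
      + ∫⁻ x in S, ENNReal.ofReal (Pfun g (u.A x) (u.B x)) := by
  have i1 : IntegrableOn (fun x => (ϵ/2) * u.f x ^ 2) S :=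
    (m1.integrable_sq.const_mul _).integrableOn
  have i2 : IntegrableOn (fun x => (1/2) * u.h x ^ 2) S :=
    (m2.integrable_sq.const_mul _).integrableOn
  rw [← integral_const_mul, ← integral_const_mul, ← integral_add i1 i2,
    ofReal_integral_eq_lintegral_ofReal
      (f := fun x => (ϵ/2) * u.f x ^ 2 + (1/2) * u.h x ^ 2) (Integrable.add i1 i2)
      (Eventually.of_forall fun x => by positivity)]
  unfold En
  rw [← lintegral_add_right _ (PAB_cont g u).measurable.ennreal_ofReal]
  congr 1; funext x
  rw [← ENNReal.ofReal_add (by positivity) (Pfun_nonneg hg _ _)]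
  rfl

lemma liminf_add_aux {y p : ℕ → ℝ≥0∞} {a q c : ℝ≥0∞} (hy : Tendsto y atTop (nhds a))
    (hq : q ≤ liminf p atTop) (hf : ∃ᶠ n in atTop, y n + p n ≤ c) : a + q ≤ c := by
  refine (add_le_add le_rfl hq).trans ?_
  rw [liminf_eq_iSup_iInf_of_nat, ENNReal.add_iSup]
  refine iSup_le fun i => ?_
  have hcl : IsClosed {z : ℝ≥0∞ | z + ⨅ n ≥ i, p n ≤ c} :=
    isClosed_le (by fun_prop) continuous_const
  refine hcl.mem_of_frequently_of_tendsto ?_ hy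
  refine (hf.and_eventually (eventually_ge_atTop i)).mono fun n hn => ?_
  refine le_trans (add_le_add le_rfl ?_) hn.1
  exact iInf₂_le n hn.2

lemma lsc {ϵ g : ℝ} (hϵ : 0 < ϵ) (hg : 1 < g) (u : ℕ → Pth) (v : Pth)
    (m1 : ∀ n, MemLp (u n).f 2 volume) (m2 : ∀ n, MemLp (u n).h 2 volume)
    (lF : MemLp v.f 2 volume) (lH : MemLp v.h 2 volume)
    (wF : ∀ φ : ℝ → ℝ, MemLp φ 2 volume →
        Tendsto (fun n => ∫ x, (u n).f x * φ x) atTop (nhds (∫ x, v.f x * φ x)))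
    (wH : ∀ φ : ℝ → ℝ, MemLp φ 2 volume →
        Tendsto (fun n => ∫ x, (u n).h x * φ x) atTop (nhds (∫ x, v.h x * φ x)))
    (cA : ∀ x, Tendsto (fun n => (u n).A x) atTop (nhds (v.A x)))
    (cB : ∀ x, Tendsto (fun n => (u n).B x) atTop (nhds (v.B x)))
    (S : Set ℝ) (c : ℝ≥0∞) (hS : MeasurableSet S)
    (hfr : ∃ᶠ n in atTop, En ϵ g (u n) S ≤ c) : En ϵ g v S ≤ c := by
  rw [En_decomp hϵ hg v lF lH S]
  let Y : ℕ → ℝ := fun n =>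
    (ϵ/2) * (2 * (∫ x in S, (u n).f x * v.f x) - ∫ x in S, v.f x ^ 2)
    + (1/2) * (2 * (∫ x in S, (u n).h x * v.h x) - ∫ x in S, v.h x ^ 2)
  have hY : Tendsto Y atTop (nhds ((ϵ/2) * (∫ x in S, v.f x ^ 2) + (1/2) * (∫ x in S, v.h x ^ 2))) := by
    have := ((((weak_set lF wF hS).const_mul 2).sub_const (∫ x in S, v.f x ^ 2)).const_mul (ϵ/2)).add
      ((((weak_set lH wH hS).const_mul 2).sub_const (∫ x in S, v.h x ^ 2)).const_mul (1/2))
    convert this using 2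
    ring
  have hYle : ∀ n, ENNReal.ofReal (Y n) + ∫⁻ x in S, ENNReal.ofReal
      (Pfun g ((u n).A x) ((u n).B x)) ≤ En ϵ g (u n) S := by
    intro n
    rw [En_decomp hϵ hg (u n) (m1 n) (m2 n) S]
    have s1 := sq_ineq (m1 n) lF S
    have s2 := sq_ineq (m2 n) lH S
    simp only [Y]
    gcongr
  have hP : ∫⁻ x in S, ENNReal.ofReal (Pfun g (v.A x) (v.B x)) ≤
      liminf (fun n => ∫⁻ x in S, ENNReal.ofReal
      (Pfun g ((u n).A x) ((u n).B x))) atTop := by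
    have ht : ∀ x, Tendsto (fun n => Pfun g ((u n).A x) ((u n).B x)) atTop
        (nhds (Pfun g (v.A x) (v.B x))) := by
      intro x
      unfold Pfun
      exact (((((cA x).pow 2).add ((cB x).pow 2)).sub_const 1).pow 2 |>.const_mul (1/4)).add
        ((((cA x).pow 2).const_mul _).mul ((cB x).pow 2))
    have e : ∫⁻ x in S, ENNReal.ofReal (Pfun g (v.A x) (v.B x)) = ∫⁻ x in S,
        liminf (fun n => ENNReal.ofReal (Pfun g ((u n).A x) ((u n).B x))) atTop :=
      lintegral_congr fun x => (Tendsto.liminf_eq (ENNReal.tendsto_ofReal (ht x))).symm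
    rw [e]
    exact lintegral_liminf_le (fun n => (PAB_cont g (u n)).measurable.ennreal_ofReal)
  exact liminf_add_aux (ENNReal.tendsto_ofReal hY) hP (hfr.mono fun n hn => (hYle n).trans hn)

lemma compactness {ϵ g C : ℝ} (hϵ : 0 < ϵ) (hg : 1 < g) (hC : 0 ≤ C) (u : ℕ → Pth)
    (hu : ∀ n, En ϵ g (u n) Set.univ ≤ ENNReal.ofReal C) :
    ∃ (v : Pth) (k : ℕ → ℕ), StrictMono k ∧
      (∀ x, Tendsto (fun n => (u (k n)).A x) atTop (nhds (v.A x))) ∧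
      (∀ x, Tendsto (fun n => (u (k n)).A1 x) atTop (nhds (v.A1 x))) ∧
      (∀ x, Tendsto (fun n => (u (k n)).B x) atTop (nhds (v.B x))) ∧
      (∀ (S : Set ℝ) (c : ℝ≥0∞), MeasurableSet S →
        (∃ᶠ n in atTop, En ϵ g (u (k n)) S ≤ c) → En ϵ g v S ≤ c) := by
  obtain ⟨M, hM⟩ := bdd0 hϵ hg hC
  have hb := fun n => basics hϵ hg hC (u n) (hu n)
  obtain ⟨F, mF, lF, k1, hk1, wF⟩ := weakL2 (fun n => (u n).f) (fun n => (hb n).1) _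
    (fun n => (hb n).2.2.2.1)
  obtain ⟨H, mH, lH, k2, hk2, wH⟩ := weakL2 (fun n => (u (k1 n)).h) (fun n => (hb (k1 n)).2.1) _
    (fun n => (hb (k1 n)).2.2.2.2.1)
  have hbd : ∀ n, ((u (k1 (k2 n))).A 0, (u (k1 (k2 n))).A1 0, (u (k1 (k2 n))).B 0) ∈
      Metric.closedBall (0 : ℝ × ℝ × ℝ) M := by
    intro n
    obtain ⟨h1, h2, h3⟩ := hM _ (hu (k1 (k2 n)))
    simp [Prod.norm_def, h1, h2, h3]
  obtain ⟨⟨a0, a1, b0⟩, -, k3, hk3, hlim⟩ := tendsto_subseq_of_bounded Metric.isBounded_closedBall hbd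
  obtain ⟨k, hk⟩ : ∃ k : ℕ → ℕ, k = fun n => k1 (k2 (k3 n)) := ⟨_, rfl⟩
  have hkm : StrictMono k := by rw [hk]; exact hk1.comp (hk2.comp hk3)
  have wF' : ∀ φ : ℝ → ℝ, MemLp φ 2 volume →
        Tendsto (fun n => ∫ x, (u (k n)).f x * φ x) atTop (nhds (∫ x, F x * φ x)) := by
    intro φ hφ
    rw [hk]
    exact (wF φ hφ).comp ((hk2.comp hk3).tendsto_atTop)
  have wH' : ∀ φ : ℝ → ℝ, MemLp φ 2 volume →
        Tendsto (fun n => ∫ x, (u (k n)).h x * φ x) atTop (nhds (∫ x, H x * φ x)) := by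
    intro φ hφ
    rw [hk]
    exact (wH φ hφ).comp (hk3.tendsto_atTop)
  have l0 : Tendsto (fun n => (u (k n)).A 0) atTop (nhds a0) := by
    rw [hk]; exact (continuous_fst.tendsto _).comp hlim
  have l1 : Tendsto (fun n => (u (k n)).A1 0) atTop (nhds a1) := by
    rw [hk]; exact ((continuous_fst.comp continuous_snd).tendsto _).comp hlim
  have l2 : Tendsto (fun n => (u (k n)).B 0) atTop (nhds b0) := by
    rw [hk]; exact ((continuous_snd.comp continuous_snd).tendsto _).comp hlim
  have iF : ∀ x y, IntervalIntegrable F volume x y := fun x y =>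
    ((lF.locallyIntegrable (by norm_num)).integrableOn_isCompact
      isCompact_uIcc).intervalIntegrable
  have iH : ∀ x y, IntervalIntegrable H volume x y := fun x y =>
    ((lH.locallyIntegrable (by norm_num)).integrableOn_isCompact
      isCompact_uIcc).intervalIntegrable
  have q1 : IsPrim (fun x => a1 + ∫ t in (0:ℝ)..x, F t) F :=
    isPrim_of_base 0 iF (by intro x; simp)
  have q2 : IsPrim (fun x => a0 + ∫ t in (0:ℝ)..x, (a1 + ∫ t in (0:ℝ)..t, F t))
      (fun x => a1 + ∫ t in (0:ℝ)..x, F t) :=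
    isPrim_of_base 0 (fun x y => q1.continuous.intervalIntegrable x y) (by intro x; simp)
  have q3 : IsPrim (fun x => b0 + ∫ t in (0:ℝ)..x, H t) H :=
    isPrim_of_base 0 iH (by intro x; simp)
  let v : Pth := ⟨_, _, F, _, H, mF, mH, q1, q2, q3⟩
  have cA1 : ∀ x, Tendsto (fun n => (u (k n)).A1 x) atTop (nhds (v.A1 x)) := by
    intro x
    have h := l1.add (weak_interval wF' 0 x)
    refine h.congr fun n => ?_
    rw [← (u (k n)).pA1.2]; ring
  have cB : ∀ x, Tendsto (fun n => (u (k n)).B x) atTop (nhds (v.B x)) := by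
    intro x
    have h := l2.add (weak_interval wH' 0 x)
    refine h.congr fun n => ?_
    rw [← (u (k n)).pB.2]; ring
  have cA : ∀ x, Tendsto (fun n => (u (k n)).A x) atTop (nhds (v.A x)) := by
    intro x
    have hd : Tendsto (fun n => ∫ t in (0:ℝ)..x, (u (k n)).A1 t) atTop
        (nhds (∫ t in (0:ℝ)..x, v.A1 t)) := by
      refine intervalIntegral.tendsto_integral_filter_of_dominated_convergence
        (fun _ => M + (|x| + 2 * C / ϵ) / 2)
        (Eventually.of_forall fun n => (u (k n)).cA1.aestronglyMeasurable) ?_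
        intervalIntegrable_const (Eventually.of_forall fun t _ => cA1 t)
      refine Eventually.of_forall fun n => Eventually.of_forall fun t ht => ?_
      have h1 := prim_bound (u (k n)).pA1 (hb (k n)).1 (hb (k n)).2.2.2.1 t
      have h2 := (hM _ (hu (k n))).2.1
      have h3 : |t| ≤ |x| := by
        rcases le_total 0 x with h | h
        · rw [Set.uIoc_of_le h] at ht
          rw [abs_of_pos ht.1, abs_of_nonneg h]; exact ht.2
        · rw [Set.uIoc_of_ge h] at ht
          rw [abs_of_nonpos ht.2, abs_of_nonpos h]; linarith [ht.1]
      have h4 := abs_sub_abs_le_abs_sub ((u (k n)).A1 t) ((u (k n)).A1 0)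
      rw [Real.norm_eq_abs]
      linarith
    have h := l0.add hd
    refine h.congr fun n => ?_
    rw [← (u (k n)).pA.2]; ring
  refine ⟨v, k, hkm, cA, cA1, cB, fun S c hS hfr => ?_⟩
  exact lsc hϵ hg (fun n => u (k n)) v (fun n => (hb (k n)).1) (fun n => (hb (k n)).2.1) lF lH
    wF' wH' cA cB S c hS hfr

def near0 (u : Pth) (x η : ℝ) : Prop :=
  ∃ σ : ℝ, σ ^ 2 = 1 ∧ |u.A x - σ| ≤ η ∧ |u.A1 x| ≤ η ∧ |u.B x| ≤ η

def near1 (u : Pth) (x η : ℝ) : Prop :=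
  ∃ τ : ℝ, τ ^ 2 = 1 ∧ |u.A x| ≤ η ∧ |u.A1 x| ≤ η ∧ |u.B x - τ| ≤ η

lemma sq_aux {σ a b : ℝ} (hσ : σ ^ 2 = 1) (h1 : |a - σ| ≤ 1/4) (h2 : |b| ≤ 1/4) : b ^ 2 < a ^ 2 := by
  rw [abs_le] at h1 h2
  have hσ' : (σ - 1) * (σ + 1) = 0 := by linear_combination hσ
  rcases mul_eq_zero.1 hσ' with h | h <;> nlinarith

lemma near0.phi {u : Pth} {x η : ℝ} (hη : η ≤ 1/4) (h : near0 u x η) : phi u x < 0 := by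
  obtain ⟨σ, h1, h2, -, h4⟩ := h
  have := sq_aux h1 (h2.trans hη) (h4.trans hη)
  unfold _root_.phi; linarith

lemma near1.phi {u : Pth} {x η : ℝ} (hη : η ≤ 1/4) (h : near1 u x η) : 0 < phi u x := by
  obtain ⟨σ, h1, h2, -, h4⟩ := h
  have := sq_aux h1 (h4.trans hη) (h2.trans hη)
  unfold _root_.phi; linarith

lemma near0.shift {u : Pth} {x s η : ℝ} : near0 (u.shift s) x η ↔ near0 u (x + s) η := Iff.rfl
lemma near1.shift {u : Pth} {x s η : ℝ} : near1 (u.shift s) x η ↔ near1 u (x + s) η := Iff.rfl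

lemma En_zero_well {ϵ g : ℝ} (hϵ : 0 < ϵ) (hg : 1 < g) (v : Pth)
    (hv : En ϵ g v (Set.Icc (-1) 1) = 0) : near0 v 0 0 ∨ near1 v 0 0 := by
  have hP : ∀ x ∈ Set.Icc (-1:ℝ) 1, Pfun g (v.A x) (v.B x) = 0 := by
    have h1 := (lintegral_eq_zero_iff (dens_meas ϵ g v).ennreal_ofReal).1 hv
    have h2 : (fun x => Pfun g (v.A x) (v.B x)) =ᵐ[volume.restrict (Set.Icc (-1:ℝ) 1)]
        fun _ => 0 := by
      filter_upwards [h1] with x hx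
      have hx' : dens ϵ g v x ≤ 0 := by simpa using hx
      have h3 := Pfun_nonneg hg (v.A x) (v.B x)
      have h4 : 0 ≤ ϵ / 2 * v.f x ^ 2 := by positivity
      have h5 : 0 ≤ v.h x ^ 2 := by positivity
      unfold dens at hx'
      linarith
    exact Measure.eqOn_Icc_of_ae_eq volume (by norm_num) h2 (PAB_cont g v).continuousOn
      continuousOn_const
  have hab : ∀ x ∈ Set.Icc (-1:ℝ) 1, v.A x ^ 2 + v.B x ^ 2 = 1 ∧ v.A x * v.B x = 0 := by
    intro x hx
    have h := hP x hx
    unfold Pfun at h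
    have hg' : 0 < g - 1 := by linarith
    have e1 : (v.A x ^ 2 + v.B x ^ 2 - 1) ^ 2 = 0 := by
      have : 0 ≤ 1 / 2 * (g - 1) * v.A x ^ 2 * v.B x ^ 2 := by positivity
      nlinarith [sq_nonneg (v.A x ^ 2 + v.B x ^ 2 - 1)]
    have e2 : 1 / 2 * (g - 1) * (v.A x * v.B x) ^ 2 = 0 := by
      rw [e1] at h; linear_combination h
    have e3 : (v.A x * v.B x) ^ 2 = 0 := by
      rcases mul_eq_zero.1 e2 with h' | h'
      · linarith
      · exact h'
    exact ⟨by linarith [pow_eq_zero_iff (two_ne_zero) |>.1 e1], pow_eq_zero_iff (two_ne_zero) |>.1 e3⟩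
  have hcub : ∀ x ∈ Set.Icc (-1:ℝ) 1, v.A x ^ 3 - v.A x = 0 := by
    intro x hx
    obtain ⟨h1, h2⟩ := hab x hx
    linear_combination v.A x * h1 - v.B x * h2
  have hd : HasDerivAt (fun x => v.A x ^ 3 - v.A x) (3 * v.A 0 ^ 2 * v.A1 0 - v.A1 0) 0 := by
    have h1 := v.pA.hasDerivAt v.cA1 0
    have := (h1.pow 3).sub h1
    refine HasDerivAt.congr_deriv this ?_
    push_cast; ring
  have hd0 : HasDerivAt (fun x => v.A x ^ 3 - v.A x) 0 0 := by
    refine (hasDerivAt_const (0:ℝ) (0:ℝ)).congr_of_eventuallyEq ?_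
    filter_upwards [Icc_mem_nhds (show (-1:ℝ) < 0 by norm_num) (show (0:ℝ) < 1 by norm_num)]
      with x hx using hcub x hx
  have hA1 := hd.unique hd0
  obtain ⟨h1, h2⟩ := hab 0 (by norm_num)
  rcases mul_eq_zero.1 h2 with h | h
  · right
    have e : v.A1 0 = 0 := by rw [h] at hA1; linarith
    exact ⟨v.B 0, by rw [h] at h1; linarith, by simp [h], by simp [e], by simp⟩
  · left
    have e0 : v.A 0 ^ 2 = 1 := by rw [h] at h1; linarith
    have e : v.A1 0 = 0 := by rw [e0] at hA1; linarith
    exact ⟨v.A 0, e0, by simp, by simp [e], by simp [h]⟩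

lemma eta {ϵ g C : ℝ} (hϵ : 0 < ϵ) (hg : 1 < g) (hC : 0 ≤ C) {η : ℝ} (hη : 0 < η) :
    ∃ δ : ℝ, 0 < δ ∧ ∀ u : Pth, En ϵ g u Set.univ ≤ ENNReal.ofReal C → ∀ x,
      En ϵ g u (Set.Icc (x-1) (x+1)) ≤ ENNReal.ofReal δ → near0 u x η ∨ near1 u x η := by
  by_contra! hcon
  choose u hu x hx hn using fun n : ℕ => hcon (1 / ((n:ℝ) + 1)) (by positivity)
  obtain ⟨v, k, hk, cA, cA1, cB, hl⟩ := compactness hϵ hg hC (fun n => (u n).shift (x n))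
    (fun n => by
      have := En_shift ϵ g (u n) (x n) Set.univ MeasurableSet.univ
      rw [Set.preimage_univ] at this
      rw [this]; exact hu n)
  have hz : En ϵ g v (Set.Icc (-1) 1) = 0 := by
    have hb : ∀ m : ℕ, En ϵ g v (Set.Icc (-1) 1) ≤ ENNReal.ofReal (1 / ((m:ℝ) + 1)) := by
      intro m
      refine hl _ _ measurableSet_Icc (Eventually.frequently ?_)
      filter_upwards [hk.tendsto_atTop.eventually (eventually_ge_atTop m)] with n hn
      have e := En_shift ϵ g (u (k n)) (x (k n)) (Set.Icc (x (k n) - 1) (x (k n) + 1))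
        measurableSet_Icc
      have e2 : (fun t => t + x (k n)) ⁻¹' (Set.Icc (x (k n) - 1) (x (k n) + 1))
          = Set.Icc (-1) 1 := by
        ext t; simp only [Set.mem_preimage, Set.mem_Icc]
        constructor <;> rintro ⟨h1, h2⟩ <;> constructor <;> linarith
      rw [e2] at e
      rw [e]
      refine (hx (k n)).trans (ENNReal.ofReal_le_ofReal ?_)
      have : (m:ℝ) ≤ k n := by exact_mod_cast hn
      gcongr
    have hlim : Tendsto (fun m : ℕ => ENNReal.ofReal (1 / ((m : ℝ) + 1))) atTop (nhds 0) := by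
      have := ENNReal.tendsto_ofReal (tendsto_one_div_add_atTop_nhds_zero_nat (𝕜 := ℝ))
      simpa using this
    exact nonpos_iff_eq_zero.1 (ge_of_tendsto' hlim hb)
  have hw := En_zero_well hϵ hg v hz
  have hA : ∀ᶠ n in atTop, |(u (k n)).A (0 + x (k n)) - v.A 0| < η :=
    (Metric.tendsto_nhds.1 (cA 0)) η hη
  have hA1 : ∀ᶠ n in atTop, |(u (k n)).A1 (0 + x (k n)) - v.A1 0| < η :=
    (Metric.tendsto_nhds.1 (cA1 0)) η hη
  have hB : ∀ᶠ n in atTop, |(u (k n)).B (0 + x (k n)) - v.B 0| < η :=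
    (Metric.tendsto_nhds.1 (cB 0)) η hη
  obtain ⟨n, h1, h2, h3⟩ := (hA.and (hA1.and hB)).exists
  rw [zero_add] at h1 h2 h3
  obtain ⟨n0, n1⟩ := hn (k n)
  rcases hw with ⟨σ, q1, q2, q3, q4⟩ | ⟨σ, q1, q2, q3, q4⟩
  · refine n0 ⟨σ, q1, ?_, ?_, ?_⟩
    all_goals simp only [abs_nonpos_iff] at q2 q3 q4
    · rw [← sub_eq_zero.1 q2]; exact h1.le
    · rw [q3, sub_zero] at h2; exact h2.le
    · rw [q4, sub_zero] at h3; exact h3.le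
  · refine n1 ⟨σ, q1, ?_, ?_, ?_⟩
    all_goals simp only [abs_nonpos_iff] at q2 q3 q4
    · rw [q2, sub_zero] at h1; exact h1.le
    · rw [q3, sub_zero] at h2; exact h2.le
    · rw [← sub_eq_zero.1 q4]; exact h3.le


lemma tail {ϵ g : ℝ} (hϵ : 0 < ϵ) (hg : 1 < g) (u : Pth) (hu : En ϵ g u Set.univ < ⊤)
    {l : Filter ℝ} [l.IsCountablyGenerated] (hl : Tendsto (fun x : ℝ => |x|) l atTop)
    {δ : ℝ} (hδ : 0 < δ) :
    ∀ᶠ x in l, En ϵ g u (Set.Icc (x-1) (x+1)) ≤ ENNReal.ofReal δ := by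
  have hi := int_dens hϵ hg u hu
  have h1 : Tendsto (fun x => ∫ t, (Set.Icc (x-1) (x+1)).indicator (dens ϵ g u) t) l
      (nhds (∫ t : ℝ, (0:ℝ))) := by
    refine tendsto_integral_filter_of_dominated_convergence (dens ϵ g u) ?_ ?_ hi ?_
    · exact Eventually.of_forall fun x =>
        ((dens_meas ϵ g u).indicator measurableSet_Icc).aestronglyMeasurable
    · refine Eventually.of_forall fun x => Eventually.of_forall fun t => ?_
      refine (norm_indicator_le_norm_self _ _).trans ?_
      rw [Real.norm_of_nonneg (dens_nonneg hϵ hg u t)]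
    · refine Eventually.of_forall fun t => tendsto_const_nhds.congr' ?_
      filter_upwards [hl.eventually (eventually_gt_atTop (|t| + 1))] with x hx
      rw [Set.indicator_of_notMem]
      rintro ⟨a, b⟩
      have : |x - t| ≤ 1 := abs_le.2 ⟨by linarith, by linarith⟩
      have := abs_sub_abs_le_abs_sub x t
      linarith
  rw [integral_zero] at h1
  filter_upwards [h1.eventually (gt_mem_nhds hδ)] with x hx
  rw [En_eq hϵ hg u hu, ← integral_indicator measurableSet_Icc]
  exact ENNReal.ofReal_le_ofReal hx.le

lemma tail_near {ϵ g : ℝ} (hϵ : 0 < ϵ) (hg : 1 < g) (u : Pth) (hu : En ϵ g u Set.univ < ⊤)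
    {l : Filter ℝ} [l.IsCountablyGenerated] (hl : Tendsto (fun x : ℝ => |x|) l atTop)
    {η : ℝ} (hη : 0 < η) : ∀ᶠ x in l, near0 u x η ∨ near1 u x η := by
  obtain ⟨δ, hδ, h⟩ := eta (C := (En ϵ g u Set.univ).toReal) hϵ hg ENNReal.toReal_nonneg hη
  filter_upwards [tail hϵ hg u hu hl hδ] with x hx
  exact h u (by rw [ENNReal.ofReal_toReal hu.ne]) x hx

lemma inY.shift {u : Pth} (h : inY u) (s : ℝ) : inY (u.shift s) :=
  ⟨(tendsto_atBot_add_const_right _ s tendsto_id).eventually h.1,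
   (tendsto_atTop_add_const_right _ s tendsto_id).eventually h.2⟩

lemma En_shift_univ (ϵ g : ℝ) (u : Pth) (s : ℝ) :
    En ϵ g (u.shift s) Set.univ = En ϵ g u Set.univ := by
  have := En_shift ϵ g u s Set.univ MeasurableSet.univ
  rwa [Set.preimage_univ] at this

lemma first_zero {u : Pth} (h : inY u) : ∃ s, phi u s = 0 ∧ ∀ x ≤ s, phi u x ≤ 0 := by
  have hc := phi_cont u
  have hcl : IsClosed {x | 0 ≤ phi u x} := isClosed_le continuous_const hc
  obtain ⟨b, hb⟩ := h.2.exists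
  obtain ⟨a, ha⟩ := eventually_atBot.1 h.1
  have hbd : BddBelow {x | 0 ≤ phi u x} := by
    refine ⟨a, fun x hx => ?_⟩
    by_contra! hlt
    exact absurd (ha x hlt.le) (not_lt.2 hx)
  have hmem := hcl.csInf_mem ⟨b, hb.le⟩ hbd
  set s := sInf {x | 0 ≤ phi u x} with hs
  have hlt : ∀ x < s, phi u x < 0 := fun x hx => by
    by_contra! hge
    exact absurd (csInf_le hbd hge) (not_le.2 hx)
  have hle : phi u s ≤ 0 := by
    refine le_of_tendsto (hc.continuousAt.tendsto.mono_left (nhdsWithin_le_nhds (s := Set.Iio s))) ?_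
    filter_upwards [self_mem_nhdsWithin] with x hx using (hlt x hx).le
  refine ⟨s, le_antisymm hle hmem, fun x hx => ?_⟩
  rcases hx.lt_or_eq with h | h
  · exact (hlt x h).le
  · rw [h]; exact hle

lemma exists_min {ϵ g : ℝ} (hϵ : 0 < ϵ) (hg : 1 < g) :
    ∃ v, inY v ∧ En ϵ g v Set.univ < ⊤ ∧ ∀ w, inY w → En ϵ g v Set.univ ≤ En ϵ g w Set.univ := by
  obtain ⟨v0, hv0, hf0⟩ := exists_finite hϵ hg
  obtain ⟨m, hm⟩ : ∃ m : ℝ≥0∞, m = ⨅ w : {w : Pth // inY w}, En ϵ g w.1 Set.univ := ⟨_, rfl⟩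
  have hml : ∀ w, inY w → m ≤ En ϵ g w Set.univ := fun w hw => by
    rw [hm]; exact iInf_le (fun w : {w : Pth // inY w} => En ϵ g w.1 Set.univ) ⟨w, hw⟩
  have hmt : m < ⊤ := (hml v0 hv0).trans_lt hf0
  have hC : 0 ≤ m.toReal + 1 := by positivity
  obtain ⟨δ, hδ, heta⟩ := eta hϵ hg hC (η := 1/4) (by norm_num)
  obtain ⟨r, hr0, hr1, hr2⟩ : ∃ r : ℝ, 0 < r ∧ r ≤ 1/4 ∧ Kb ϵ g r ≤ δ / 2 := by
    have hc : Continuous (Kb ϵ g) := by unfold Kb; fun_prop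
    have h0 : Kb ϵ g 0 = 0 := by simp [Kb]
    have h1 : ∀ᶠ r in nhds (0:ℝ), Kb ϵ g r < δ / 2 :=
      hc.continuousAt.eventually_lt continuousAt_const (by rw [h0]; positivity)
    have h2 : ∀ᶠ r in nhds (0:ℝ), r < 1/4 := gt_mem_nhds (by norm_num)
    have h3 := ((h1.and h2).filter_mono (nhdsWithin_le_nhds (s := Set.Ioi 0))).and
      self_mem_nhdsWithin
    obtain ⟨r, ⟨a, b⟩, c⟩ := h3.exists
    exact ⟨r, c, b.le, a.le⟩
  obtain ⟨κ, hκ0, hκ1, hκ2⟩ : ∃ κ : ℝ, 0 < κ ∧ κ ≤ 1 ∧ κ ≤ δ / 2 :=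
    ⟨min 1 (δ/2), by positivity, min_le_left _ _, min_le_right _ _⟩
  have hseq : ∀ n : ℕ, ∃ u : Pth, inY u ∧
      En ϵ g u Set.univ ≤ m + ENNReal.ofReal (κ / ((n:ℝ) + 1)) ∧ phi u 0 = 0 ∧
      ∀ x ≤ 0, phi u x ≤ 0 := by
    intro n
    have hpos : 0 < κ / ((n:ℝ) + 1) := by positivity
    have hlt : m < m + ENNReal.ofReal (κ / ((n:ℝ) + 1)) :=
      ENNReal.lt_add_right hmt.ne (by simpa using hpos)
    nth_rewrite 1 [hm] at hlt
    obtain ⟨⟨w, hw⟩, hwl⟩ := iInf_lt_iff.1 hlt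
    obtain ⟨s, hs1, hs2⟩ := first_zero hw
    refine ⟨w.shift s, hw.shift s, ?_, ?_, ?_⟩
    · rw [En_shift_univ]; exact hwl.le
    · change phi w (0 + s) = 0
      rw [zero_add, hs1]
    · intro x hx
      exact hs2 (x + s) (by linarith)
  choose u huY huE hu0 hul using hseq
  have huE' : ∀ n, En ϵ g (u n) Set.univ ≤ m + ENNReal.ofReal κ := fun n => by
    refine (huE n).trans ?_
    gcongr
    exact div_le_self hκ0.le (by linarith [(Nat.cast_nonneg n : (0:ℝ) ≤ n)])
  have huC : ∀ n, En ϵ g (u n) Set.univ ≤ ENNReal.ofReal (m.toReal + 1) := fun n => by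
    refine (huE' n).trans ?_
    rw [ENNReal.ofReal_add ENNReal.toReal_nonneg zero_le_one, ENNReal.ofReal_toReal hmt.ne]
    gcongr
  have hnear : ∀ n, ∀ s, 1 < s → ¬ near0 (u n) s r := by
    rintro n s hs ⟨σ, q1, q2, q3, q4⟩
    obtain ⟨v, hvY, hvE⟩ := connect hϵ hg q1 (u n) s (huY n).2 q2 q3 q4
    have h1 := (huE' n).trans (add_le_add_left ((hml v hvY).trans hvE) (ENNReal.ofReal κ))
    have hfin : En ϵ g (u n) (Set.Ici s) ≠ ⊤ :=
      ((En_mono ϵ g (u n) (Set.subset_univ _)).trans (huC n)).trans_lt ENNReal.ofReal_lt_top |>.ne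
    rw [En_split ϵ g _ s] at h1
    have h2 : En ϵ g (u n) (Set.Iio s) ≤ ENNReal.ofReal (Kb ϵ g r) + ENNReal.ofReal κ := by
      rw [add_right_comm] at h1
      exact (ENNReal.add_le_add_iff_right hfin).1 h1
    have h3 : En ϵ g (u n) (Set.Icc (0-1) (0+1)) ≤ ENNReal.ofReal δ := by
      refine (En_mono ϵ g (u n) (fun x hx => ?_)).trans (h2.trans ?_)
      · exact lt_of_le_of_lt hx.2 (by linarith)
      · rw [← add_halves δ, ENNReal.ofReal_add (by positivity) (by positivity)]
        gcongr
    rcases heta (u n) (huC n) 0 h3 with h | h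
    · exact absurd (hu0 n) (h.phi le_rfl).ne
    · exact absurd (hu0 n) (h.phi le_rfl).ne'
  obtain ⟨v, k, hk, cA, cA1, cB, hl⟩ := compactness hϵ hg hC u huC
  have hvm : En ϵ g v Set.univ ≤ m := by
    have hb : ∀ j : ℕ, En ϵ g v Set.univ ≤ m + ENNReal.ofReal (κ / ((j:ℝ) + 1)) := by
      intro j
      refine hl _ _ MeasurableSet.univ (Eventually.frequently ?_)
      filter_upwards [hk.tendsto_atTop.eventually (eventually_ge_atTop j)] with n hn
      refine (huE _).trans ?_
      have : (j:ℝ) ≤ k n := by exact_mod_cast hn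
      gcongr
    have hlim : Tendsto (fun j : ℕ => m + ENNReal.ofReal (κ / ((j : ℝ) + 1))) atTop
        (nhds (m + 0)) := by
      refine Tendsto.const_add _ ?_
      have := ENNReal.tendsto_ofReal
        ((tendsto_one_div_add_atTop_nhds_zero_nat (𝕜 := ℝ)).const_mul κ)
      simpa [div_eq_mul_inv] using this
    rw [add_zero] at hlim
    exact ge_of_tendsto' hlim hb
  have hvt := hvm.trans_lt hmt
  have hvneg : ∀ x ≤ 0, phi v x ≤ 0 := fun x hx => by
    have : Tendsto (fun n => phi (u (k n)) x) atTop (nhds (phi v x)) :=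
      ((cB x).pow 2).sub ((cA x).pow 2)
    exact le_of_tendsto' this fun n => hul _ x hx
  have hvnear : ∀ s, 1 < s → ¬ near0 v s (r/2) := by
    rintro s hs ⟨σ, q1, q2, q3, q4⟩
    have hr2 : 0 < r / 2 := by positivity
    have hA : ∀ᶠ n in atTop, |(u (k n)).A s - v.A s| < r/2 :=
      (Metric.tendsto_nhds.1 (cA s)) _ hr2
    have hA1 : ∀ᶠ n in atTop, |(u (k n)).A1 s - v.A1 s| < r/2 :=
      (Metric.tendsto_nhds.1 (cA1 s)) _ hr2
    have hB : ∀ᶠ n in atTop, |(u (k n)).B s - v.B s| < r/2 :=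
      (Metric.tendsto_nhds.1 (cB s)) _ hr2
    obtain ⟨n, h1, h2, h3⟩ := (hA.and (hA1.and hB)).exists
    refine hnear (k n) s hs ⟨σ, q1, ?_, ?_, ?_⟩
    · rw [abs_le] at *; rw [abs_lt] at h1
      constructor <;> linarith
    · rw [abs_le] at *; rw [abs_lt] at h2
      constructor <;> linarith
    · rw [abs_le] at *; rw [abs_lt] at h3
      constructor <;> linarith
  refine ⟨v, ⟨?_, ?_⟩, hvt, fun w hw => hvm.trans (hml w hw)⟩
  · filter_upwards [tail_near hϵ hg v hvt tendsto_abs_atBot_atTop (η := 1/4) (by norm_num),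
      eventually_le_atBot 0] with x hx hx0
    rcases hx with h | h
    · exact h.phi le_rfl
    · exact absurd (hvneg x hx0) (not_le.2 (h.phi le_rfl))
  · filter_upwards [tail_near hϵ hg v hvt tendsto_abs_atTop_atTop (η := r/2) (by positivity),
      eventually_gt_atTop 1] with x hx hx0
    rcases hx with h | h
    · exact absurd h (hvnear x hx0)
    · exact h.phi (by linarith)

lemma IsPrim.eq_base {F f : ℝ → ℝ} (h : IsPrim F f) (s : ℝ) :
    F = fun x => F s + ∫ t in s..x, f t := by
  funext x; rw [← h.2]; ring

lemma IsPrim.ac {F f : ℝ → ℝ} (h : IsPrim F f) (a b : ℝ) :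
    AbsolutelyContinuousOnInterval F a b := by
  have h1 := (h.1 a b).absolutelyContinuousOnInterval_intervalIntegral (c := a) (by simp)
  have h2 : AbsolutelyContinuousOnInterval (fun _ : ℝ => F a) a b :=
    (LipschitzWith.const (F a)).lipschitzOnWith.absolutelyContinuousOnInterval
  rw [h.eq_base a]
  exact h2.add h1

lemma IsPrim.locInt {F f : ℝ → ℝ} (h : IsPrim F f) : LocallyIntegrable f volume := by
  rw [locallyIntegrable_iff]
  intro K hK
  obtain ⟨R, hR⟩ := hK.isBounded.subset_closedBall 0
  have h1 := h.1 (-|R|) |R|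
  rw [intervalIntegrable_iff_integrableOn_Icc_of_le (by linarith [abs_nonneg R])] at h1
  refine h1.mono_set fun x hx => ?_
  have := hR hx
  rw [mem_closedBall_zero_iff, Real.norm_eq_abs] at this
  exact abs_le.1 (this.trans (le_abs_self R))

lemma IsPrim.ae_hasDerivAt {F f : ℝ → ℝ} (h : IsPrim F f) : ∀ᵐ x, HasDerivAt F (f x) x := by
  filter_upwards [LocallyIntegrable.ae_hasDerivAt_integral h.locInt] with x hx
  rw [h.eq_base 0]
  exact (hx 0).const_add _

lemma IsPrim.ibp {F f G g : ℝ → ℝ} (h : IsPrim F f) (h' : IsPrim G g) (a b : ℝ) :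
    ∫ x in a..b, F x * g x = F b * G b - F a * G a - ∫ x in a..b, f x * G x := by
  have h1 := (h.ac a b).integral_mul_deriv_eq_deriv_mul (h'.ac a b)
  rw [intervalIntegral.integral_congr_ae (g := fun x => F x * deriv G x), h1]
  · congr 1
    refine intervalIntegral.integral_congr_ae ?_
    filter_upwards [h.ae_hasDerivAt] with x hx _
    rw [hx.deriv]
  · filter_upwards [h'.ae_hasDerivAt] with x hx _
    rw [hx.deriv]

lemma abs_prim {F f : ℝ → ℝ} (h : IsPrim F f) :
    IsPrim (fun x => |F x|) (deriv fun x => |F x|) := by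
  have hac : ∀ a b, AbsolutelyContinuousOnInterval (fun x => |F x|) a b := by
    intro a b
    have h1 := h.ac a b
    rw [absolutelyContinuousOnInterval_iff] at h1 ⊢
    intro ε hε
    obtain ⟨δ, hδ, hd⟩ := h1 ε hε
    refine ⟨δ, hδ, fun E hE hE' => lt_of_le_of_lt (Finset.sum_le_sum fun i _ => ?_) (hd E hE hE')⟩
    rw [Real.dist_eq, Real.dist_eq]
    exact abs_abs_sub_abs_le _ _
  exact ⟨fun x y => (hac x y).intervalIntegrable_deriv,
    fun x y => (hac x y).integral_deriv_eq_sub.symm⟩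

lemma abs_deriv_sq {F : ℝ → ℝ} {c x : ℝ} (h : HasDerivAt F c x) :
    (deriv (fun x => |F x|) x) ^ 2 ≤ c ^ 2 := by
  rcases lt_trichotomy (F x) 0 with h0 | h0 | h0
  · have h1 : HasDerivAt (fun x => |F x|) (-c) x := by
      refine h.neg.congr_of_eventuallyEq ?_
      filter_upwards [h.continuousAt.eventually_lt continuousAt_const h0] with y hy
      exact abs_of_neg hy
    rw [h1.deriv]; simp
  · have : IsLocalMin (fun x => |F x|) x := by
      refine Eventually.of_forall fun y => ?_
      simp [h0]
    rw [this.deriv_eq_zero]; nlinarith [sq_nonneg c]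
  · have h1 : HasDerivAt (fun x => |F x|) c x := by
      refine h.congr_of_eventuallyEq ?_
      filter_upwards [continuousAt_const.eventually_lt h.continuousAt h0] with y hy
      exact abs_of_pos hy
    rw [h1.deriv]

noncomputable def Pth.absB (u : Pth) : Pth where
  A := u.A
  A1 := u.A1
  f := u.f
  B x := |u.B x|
  h := deriv fun x => |u.B x|
  mf := u.mf
  mh := measurable_deriv _
  pA1 := u.pA1
  pA := u.pA
  pB := abs_prim u.pB

lemma Pfun_abs (g a b : ℝ) : Pfun g a |b| = Pfun g a b := by simp [Pfun]

lemma absB_En (ϵ g : ℝ) (u : Pth) : En ϵ g u.absB Set.univ ≤ En ϵ g u Set.univ := by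
  unfold En
  refine lintegral_mono_ae (ae_restrict_of_ae ?_)
  filter_upwards [u.pB.ae_hasDerivAt] with x hx
  refine ENNReal.ofReal_le_ofReal ?_
  have := abs_deriv_sq hx
  simp only [dens, Pth.absB, Pfun_abs]
  linarith

lemma absB_inY {u : Pth} (h : inY u) : inY u.absB := by
  have : phi u.absB = phi u := by funext x; simp [phi, Pth.absB]
  unfold inY; rw [this]; exact h

def isMin (ϵ g : ℝ) (u : Pth) : Prop :=
  inY u ∧ En ϵ g u Set.univ < ⊤ ∧ ∀ w, inY w → En ϵ g u Set.univ ≤ En ϵ g w Set.univ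

lemma absB_isMin {ϵ g : ℝ} {u : Pth} (h : isMin ϵ g u) : isMin ϵ g u.absB :=
  ⟨absB_inY h.1, (absB_En ϵ g u).trans_lt h.2.1, fun w hw => (absB_En ϵ g u).trans (h.2.2 w hw)⟩

def Supp (R : ℝ) (q : ℝ → ℝ) : Prop := ∀ x, R ≤ |x| → q x = 0

lemma Supp.integrable {R : ℝ} {q : ℝ → ℝ} (h : Supp R q) (hc : Continuous q) : Integrable q := by
  refine hc.integrable_of_hasCompactSupport
    (HasCompactSupport.intro (isCompact_Icc (a := -R) (b := R)) fun x hx => h x ?_)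
  by_contra! hle
  exact hx (abs_le.1 hle.le)

def Pth.pert (u : Pth) {φ φ1 q ψ p : ℝ → ℝ} (mq : Measurable q) (mp : Measurable p)
    (pφ1 : IsPrim φ1 q) (pφ : IsPrim φ φ1) (pψ : IsPrim ψ p) (t : ℝ) : Pth where
  A x := u.A x + t * φ x
  A1 x := u.A1 x + t * φ1 x
  f x := u.f x + t * q x
  B x := u.B x + t * ψ x
  h x := u.h x + t * p x
  mf := u.mf.add (mq.const_mul t)
  mh := u.mh.add (mp.const_mul t)
  pA1 := u.pA1.add (pφ1.const_mul t)
  pA := u.pA.add (pφ.const_mul t)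
  pB := u.pB.add (pψ.const_mul t)

def Pa (g a b : ℝ) : ℝ := (a ^ 2 + b ^ 2 - 1) * a + (g - 1) * a * b ^ 2
def Pb (g a b : ℝ) : ℝ := (a ^ 2 + b ^ 2 - 1) * b + (g - 1) * a ^ 2 * b

lemma first_var {ϵ g : ℝ} (hϵ : 0 < ϵ) (hg : 1 < g) {u : Pth} (hu : isMin ϵ g u) {R : ℝ}
    {φ φ1 q ψ p : ℝ → ℝ} (mq : Measurable q) (mp : Measurable p)
    (hq : MemLp q 2 volume) (hp : MemLp p 2 volume)
    (pφ1 : IsPrim φ1 q) (pφ : IsPrim φ φ1) (pψ : IsPrim ψ p) (sφ : Supp R φ) (sψ : Supp R ψ) :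
    (∫ x, ϵ * (u.f x * q x)) + (∫ x, u.h x * p x)
      + ∫ x, (Pa g (u.A x) (u.B x) * φ x + Pb g (u.A x) (u.B x) * ψ x) = 0 := by
  obtain ⟨hY, hfin, hmin⟩ := hu
  obtain ⟨mf, mh, -⟩ := basics hϵ hg (C := (En ϵ g u Set.univ).toReal) ENNReal.toReal_nonneg u
    (by rw [ENNReal.ofReal_toReal hfin.ne])
  have i0 := int_dens hϵ hg u hfin
  have i1 : Integrable (fun x => ϵ * (u.f x * q x)) := (mf.integrable_mul hq).const_mul ϵ
  have i2 : Integrable (fun x => u.h x * p x) := mh.integrable_mul hp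
  have cA := u.cA
  have cB := u.cB
  have cφ := pφ.continuous
  have cψ := pψ.continuous
  have i3 : Integrable (fun x => Pa g (u.A x) (u.B x) * φ x + Pb g (u.A x) (u.B x) * ψ x) := by
    refine Supp.integrable (R := R) (fun x hx => by simp [sφ x hx, sψ x hx]) ?_
    unfold Pa Pb; fun_prop
  obtain ⟨Q, hQ⟩ : ∃ Q : ℝ → ℝ, Q = fun x =>
      (1/4) * (4 * (u.A x * φ x + u.B x * ψ x)^2
        + 2 * (u.A x ^ 2 + u.B x ^ 2 - 1) * (φ x ^ 2 + ψ x ^ 2))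
      + (1/2) * (g - 1) * ((u.A x * ψ x + u.B x * φ x)^2 + 2 * (u.A x * u.B x) * (φ x * ψ x)) :=
    ⟨_, rfl⟩
  obtain ⟨T, hT⟩ : ∃ T : ℝ → ℝ, T = fun x =>
      (1/4) * (4 * (u.A x * φ x + u.B x * ψ x) * (φ x ^ 2 + ψ x ^ 2))
      + (1/2) * (g - 1) * (2 * (u.A x * ψ x + u.B x * φ x) * (φ x * ψ x)) := ⟨_, rfl⟩
  obtain ⟨W, hW⟩ : ∃ W : ℝ → ℝ, W = fun x =>
      (1/4) * (φ x ^ 2 + ψ x ^ 2)^2 + (1/2) * (g - 1) * (φ x * ψ x)^2 := ⟨_, rfl⟩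
  have iQ : Integrable Q := by
    refine Supp.integrable (R := R) (fun x hx => by simp [hQ, sφ x hx, sψ x hx]) ?_
    rw [hQ]; fun_prop
  have iT : Integrable T := by
    refine Supp.integrable (R := R) (fun x hx => by simp [hT, sφ x hx, sψ x hx]) ?_
    rw [hT]; fun_prop
  have iW : Integrable W := by
    refine Supp.integrable (R := R) (fun x hx => by simp [hW, sφ x hx, sψ x hx]) ?_
    rw [hW]; fun_prop
  have iq : Integrable (fun x => q x ^ 2) := hq.integrable_sq
  have ip : Integrable (fun x => p x ^ 2) := hp.integrable_sq
  obtain ⟨L, hL⟩ : ∃ L : ℝ → ℝ, L = fun x => ϵ * (u.f x * q x) + u.h x * p x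
    + (Pa g (u.A x) (u.B x) * φ x + Pb g (u.A x) (u.B x) * ψ x) := ⟨_, rfl⟩
  have iL : Integrable L := by rw [hL]; exact (i1.add i2).add i3
  obtain ⟨Q2, hQ2⟩ : ∃ Q2 : ℝ → ℝ, Q2 = fun x => ϵ/2 * q x ^ 2 + 1/2 * p x ^ 2 + Q x := ⟨_, rfl⟩
  have iQ2 : Integrable Q2 := by rw [hQ2]; exact ((iq.const_mul _).add (ip.const_mul _)).add iQ
  have hexp : ∀ t x, dens ϵ g (u.pert mq mp pφ1 pφ pψ t) x
      = dens ϵ g u x + t * L x + t^2 * Q2 x + t^3 * T x + t^4 * W x := by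
    intro t x
    simp only [dens, Pth.pert, hL, hQ2, hT, hW, hQ, Pfun, Pa, Pb]
    ring
  have hIntg : ∀ t, Integrable (dens ϵ g (u.pert mq mp pφ1 pφ pψ t)) ∧
      ∫ x, dens ϵ g (u.pert mq mp pφ1 pφ pψ t) x =
      (∫ x, dens ϵ g u x) + t * (∫ x, L x) + t^2 * (∫ x, Q2 x) + t^3 * (∫ x, T x)
        + t^4 * ∫ x, W x := by
    intro t
    have j1 := iL.const_mul t
    have j2 := iQ2.const_mul (t^2)
    have j3 := iT.const_mul (t^3)
    have j4 := iW.const_mul (t^4)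
    have e := funext (hexp t)
    rw [e]
    have k1 : Integrable (fun x => dens ϵ g u x + t * L x) := i0.add j1
    have k2 : Integrable (fun x => dens ϵ g u x + t * L x + t^2 * Q2 x) := k1.add j2
    have k3 : Integrable (fun x => dens ϵ g u x + t * L x + t^2 * Q2 x + t^3 * T x) := k2.add j3
    refine ⟨k3.add j4, ?_⟩
    beta_reduce
    rw [integral_add k3 j4, integral_add k2 j3, integral_add k1 j2, integral_add i0 j1]
    simp only [integral_const_mul]
  have hYt : ∀ t, inY (u.pert mq mp pφ1 pφ pψ t) := by
    intro t
    have key : ∀ x, R < |x| → phi (u.pert mq mp pφ1 pφ pψ t) x = phi u x := by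
      intro x hx
      simp [phi, Pth.pert, sφ x hx.le, sψ x hx.le]
    constructor
    · filter_upwards [hY.1, tendsto_abs_atBot_atTop.eventually (eventually_gt_atTop R)] with x h1 h2
      rw [key x h2]; exact h1
    · filter_upwards [hY.2, tendsto_abs_atTop_atTop.eventually (eventually_gt_atTop R)] with x h1 h2
      rw [key x h2]; exact h1
  have hle : ∀ t, 0 ≤ t * (∫ x, L x) + t^2 * (∫ x, Q2 x) + t^3 * (∫ x, T x)
        + t^4 * ∫ x, W x := by
    intro t
    have h1 := hmin _ (hYt t)
    have hEt : En ϵ g (u.pert mq mp pφ1 pφ pψ t) Set.univ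
        = ENNReal.ofReal (∫ x, dens ϵ g (u.pert mq mp pφ1 pφ pψ t) x) := by
      rw [ofReal_integral_eq_lintegral_ofReal (hIntg t).1
        (Eventually.of_forall (dens_nonneg hϵ hg _))]
      simp [En]
    rw [hEt, En_eq hϵ hg u hfin, Measure.restrict_univ, (hIntg t).2,
      ENNReal.ofReal_le_ofReal_iff'] at h1
    rcases h1 with h1 | h1
    · linarith
    · have h2 : 0 ≤ ∫ x, dens ϵ g (u.pert mq mp pφ1 pφ pψ t) x :=
        integral_nonneg (dens_nonneg hϵ hg _)
      rw [(hIntg t).2] at h2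
      linarith
  have hd : HasDerivAt (fun t : ℝ => t * (∫ x, L x) + t^2 * (∫ x, Q2 x) + t^3 * (∫ x, T x)
        + t^4 * ∫ x, W x) (∫ x, L x) 0 := by
    have := ((((hasDerivAt_id (0:ℝ)).mul_const (∫ x, L x)).add
      ((hasDerivAt_pow 2 (0:ℝ)).mul_const (∫ x, Q2 x))).add
      ((hasDerivAt_pow 3 (0:ℝ)).mul_const (∫ x, T x))).add
      ((hasDerivAt_pow 4 (0:ℝ)).mul_const (∫ x, W x))
    refine HasDerivAt.congr_deriv this ?_
    simp
  have hmin0 : IsLocalMin (fun t : ℝ => t * (∫ x, L x) + t^2 * (∫ x, Q2 x) + t^3 * (∫ x, T x)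
        + t^4 * ∫ x, W x) 0 := by
    refine Eventually.of_forall fun t => ?_
    have := hle t
    simpa using this
  have h0 := hmin0.hasDerivAt_eq_zero hd
  have i12 : Integrable (fun x => ϵ * (u.f x * q x) + u.h x * p x) := i1.add i2
  rw [hL, integral_add i12 i3, integral_add i1 i2] at h0
  exact h0

lemma exists_prim {F : ℝ → ℝ} (hF : Continuous F) : ∃ G, IsPrim G F :=
  ⟨fun x => ∫ t in (0:ℝ)..x, F t, isPrim_of_base 0 (fun x y => hF.intervalIntegrable x y)
    (fun x => by simp)⟩

lemma Supp.int {R : ℝ} {q : ℝ → ℝ} (h : Supp R q) : ∫ x, q x = ∫ x in (-R)..R, q x := by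
  rw [intervalIntegral.integral_eq_integral_of_support_subset]
  intro x hx
  have : |x| < R := by
    by_contra! hle
    exact hx (h x hle)
  exact ⟨(abs_lt.1 this).1, (abs_lt.1 this).2.le⟩

lemma supp_prim {R : ℝ} (hR : 0 < R) {q : ℝ → ℝ} (hi : Integrable q) (hs : Supp R q)
    (h0 : ∫ x, q x = 0) : ∃ φ, IsPrim φ q ∧ Supp R φ := by
  have hii : ∀ x y, IntervalIntegrable q volume x y := fun x y => hi.intervalIntegrable
  refine ⟨fun x => ∫ t in (-R)..x, q t, isPrim_of_base (-R) hii (fun x => by simp), ?_⟩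
  intro x hx
  beta_reduce
  have hz : ∀ a b : ℝ, (∀ t ∈ Set.uIcc a b, R ≤ |t|) → ∫ t in a..b, q t = 0 := by
    intro a b hab
    rw [intervalIntegral.integral_congr (g := fun _ => 0) fun t ht => hs t (hab t ht)]
    simp
  rcases le_abs.1 hx with h | h
  · rw [← intervalIntegral.integral_add_adjacent_intervals (hii (-R) R) (hii R x), ← hs.int, h0,
      hz R x, add_zero]
    intro t ht
    rw [Set.uIcc_of_le h] at ht
    exact ht.1.trans (le_abs_self t)
  · refine hz _ _ fun t ht => ?_
    rw [Set.uIcc_of_ge (by linarith)] at ht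
    exact le_trans (by linarith [ht.2]) (neg_le_abs t)

lemma memLp_loc {F : ℝ → ℝ} (hF : Continuous F) (R : ℝ) :
    MemLp F 2 (volume.restrict (Set.Ioo (-R) R)) := by
  obtain ⟨M, hM⟩ := (isCompact_Icc (a := -R) (b := R)).exists_bound_of_continuousOn hF.continuousOn
  refine MemLp.of_bound hF.aestronglyMeasurable M ?_
  filter_upwards [ae_restrict_mem measurableSet_Ioo] with x hx
  exact hM x ⟨hx.1.le, hx.2.le⟩

lemma dbr {R : ℝ} (hR : 0 < R) {v : ℝ → ℝ} (mv : Measurable v)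
    (hv : MemLp v 2 (volume.restrict (Set.Ioo (-R) R)))
    (H : ∀ q : ℝ → ℝ, Measurable q → MemLp q 2 volume → Integrable q → Supp R q →
      ∫ x, q x = 0 → ∫ x, x * q x = 0 → ∫ x, v x * q x = 0) :
    ∃ a b : ℝ, ∀ᵐ x, x ∈ Set.Ioo (-R) R → v x = a + b * x := by
  set I := Set.Ioo (-R) R with hI
  have m0 : ∫ x in I, (1:ℝ) = 2 * R := by
    rw [hI, ← integral_Ioc_eq_integral_Ioo, ← intervalIntegral.integral_of_le (by linarith)]
    simp; ring
  have m1 : ∫ x in I, (x:ℝ) = 0 := by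
    rw [hI, ← integral_Ioc_eq_integral_Ioo, ← intervalIntegral.integral_of_le (by linarith)]
    simp
  have m2 : ∫ x in I, x * (x:ℝ) = 2 * R ^ 3 / 3 := by
    rw [hI, ← integral_Ioc_eq_integral_Ioo, ← intervalIntegral.integral_of_le (by linarith)]
    have : ∀ x : ℝ, x * x = x ^ 2 := fun x => by ring
    simp only [this, integral_pow]
    push_cast; ring
  obtain ⟨a, ha⟩ : ∃ a, a = (∫ x in I, v x) / (2 * R) := ⟨_, rfl⟩
  obtain ⟨b, hb⟩ : ∃ b, b = (∫ x in I, x * v x) / (2 * R ^ 3 / 3) := ⟨_, rfl⟩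
  refine ⟨a, b, ?_⟩
  obtain ⟨w, hw⟩ : ∃ w : ℝ → ℝ, w = fun x => v x - (a + b * x) := ⟨_, rfl⟩
  have mw : Measurable w := by rw [hw]; fun_prop
  have Lid : MemLp (fun x : ℝ => x) 2 (volume.restrict I) := memLp_loc continuous_id R
  have L1 : MemLp (fun x : ℝ => (1:ℝ)) 2 (volume.restrict I) := memLp_loc continuous_const R
  have Lw : MemLp w 2 (volume.restrict I) := by
    rw [hw]; exact hv.sub (memLp_loc (by fun_prop) R)
  have iw : IntegrableOn w I := Lw.integrable one_le_two
  have iv : IntegrableOn v I := hv.integrable one_le_two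
  have ixv : IntegrableOn (fun x => x * v x) I := Lid.integrable_mul hv
  have ixw : IntegrableOn (fun x => x * w x) I := Lid.integrable_mul Lw
  have ivw : IntegrableOn (fun x => v x * w x) I := hv.integrable_mul Lw
  have iww : IntegrableOn (fun x => w x * w x) I := Lw.integrable_mul Lw
  have i1 : IntegrableOn (fun x : ℝ => (1:ℝ)) I := L1.integrable one_le_two
  have ix : IntegrableOn (fun x : ℝ => x) I := Lid.integrable one_le_two
  have ixx : IntegrableOn (fun x : ℝ => x * x) I := Lid.integrable_mul Lid
  have w0 : ∫ x in I, w x = 0 := by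
    have e : ∀ x, w x = v x - (a * 1 + b * x) := fun x => by rw [hw]; ring
    simp only [e]
    have k : IntegrableOn (fun x : ℝ => a * 1 + b * x) I := (i1.const_mul a).add (ix.const_mul b)
    rw [integral_sub iv k, integral_add (i1.const_mul a) (ix.const_mul b), integral_const_mul,
      integral_const_mul, m0, m1, ha]
    field_simp; ring
  have w1 : ∫ x in I, x * w x = 0 := by
    have e : ∀ x, x * w x = x * v x - (a * x + b * (x * x)) := fun x => by rw [hw]; ring
    simp only [e]
    have k : IntegrableOn (fun x : ℝ => a * x + b * (x * x)) I :=
      (ix.const_mul a).add (ixx.const_mul b)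
    rw [integral_sub ixv k, integral_add (ix.const_mul a) (ixx.const_mul b), integral_const_mul,
      integral_const_mul, m1, m2, hb]
    field_simp; ring
  have ind : ∀ F : ℝ → ℝ, ∫ x, F x * I.indicator w x = ∫ x in I, F x * w x := by
    intro F
    rw [← integral_indicator (show MeasurableSet I from measurableSet_Ioo)]
    refine integral_congr_ae (Eventually.of_forall fun x => ?_)
    by_cases hx : x ∈ I <;> simp [hx]
  have key := H (I.indicator w) (mw.indicator measurableSet_Ioo)
    ((memLp_indicator_iff_restrict measurableSet_Ioo).2 Lw)
    ((integrable_indicator_iff measurableSet_Ioo).2 iw)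
    (fun x hx => Set.indicator_of_notMem (fun hm => by
      have := abs_lt.2 hm; linarith) _)
    (by rw [integral_indicator measurableSet_Ioo, w0])
    (by rw [ind (fun x => x), w1])
  rw [ind] at key
  have ww : ∫ x in I, w x * w x = 0 := by
    have e : ∀ x, w x * w x = v x * w x - (a * w x + b * (x * w x)) := fun x => by
      have : w x = v x - (a + b * x) := by rw [hw]
      rw [show v x = w x + (a + b * x) by rw [this]; ring]; ring
    have k : IntegrableOn (fun x : ℝ => a * w x + b * (x * w x)) I :=
      (iw.const_mul a).add (ixw.const_mul b)
    rw [integral_congr_ae (Eventually.of_forall e), integral_sub ivw k,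
      integral_add (iw.const_mul a) (ixw.const_mul b), integral_const_mul,
      integral_const_mul, w0, w1, key]
    ring
  have hz := (integral_eq_zero_iff_of_nonneg (fun x => mul_self_nonneg (w x)) iww).1 ww
  have hz2 := (ae_restrict_iff' measurableSet_Ioo).1 hz
  filter_upwards [hz2] with x hx hm
  have := hx hm
  have h3 : w x = 0 := mul_self_eq_zero.1 this
  rw [hw] at h3
  linarith

lemma glob {v : ℝ → ℝ}
    (H : ∀ R : ℝ, 0 < R → ∃ a b : ℝ, ∀ᵐ x, x ∈ Set.Ioo (-R) R → v x = a + b * x) :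
    ∃ a b : ℝ, ∀ᵐ x, v x = a + b * x := by
  choose a b hab using fun n : ℕ => H ((n:ℝ) + 1) (by positivity)
  have heq : ∀ n, a n = a 0 ∧ b n = b 0 := by
    intro n
    have h1 : (fun x => a n + b n * x) =ᵐ[volume.restrict (Set.Ioo (-1:ℝ) 1)]
        (fun x => a 0 + b 0 * x) := by
      rw [EventuallyEq, ae_restrict_iff' measurableSet_Ioo]
      filter_upwards [hab n, hab 0] with x h1 h2 hx
      have hn : (0:ℝ) ≤ n := Nat.cast_nonneg n
      rw [← h1 ⟨by linarith [hx.1], by linarith [hx.2]⟩, ← h2 (by simpa using hx)]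
    have h2 := Measure.eqOn_open_of_ae_eq h1 isOpen_Ioo (by fun_prop) (by fun_prop)
    have e0 := h2 (show (0:ℝ) ∈ Set.Ioo (-1:ℝ) 1 by norm_num)
    have e1 := h2 (show (1/2:ℝ) ∈ Set.Ioo (-1:ℝ) 1 by norm_num)
    simp only at e0 e1
    constructor <;> linarith
  refine ⟨a 0, b 0, ?_⟩
  filter_upwards [ae_all_iff.2 hab] with x hx
  obtain ⟨n, hn⟩ := exists_nat_gt |x|
  have := hx n (abs_lt.1 (by linarith))
  rw [this, (heq n).1, (heq n).2]

lemma isPrim_zero : IsPrim (fun _ => 0) (fun _ => 0) := ⟨fun _ _ => by simp, fun _ _ => by simp⟩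

lemma el_B {ϵ g : ℝ} (hϵ : 0 < ϵ) (hg : 1 < g) {u : Pth} (hu : isMin ϵ g u) {H : ℝ → ℝ}
    (hH : IsPrim H (fun x => Pb g (u.A x) (u.B x))) :
    ∃ a b : ℝ, ∀ᵐ x, u.h x - H x = a + b * x := by
  obtain ⟨mf, mh, -⟩ := basics hϵ hg (C := (En ϵ g u Set.univ).toReal) ENNReal.toReal_nonneg u
    (by rw [ENNReal.ofReal_toReal hu.2.1.ne])
  refine glob fun R hR => dbr hR (u.mh.sub hH.continuous.measurable)
    ((mh.restrict _).sub (memLp_loc hH.continuous R)) ?_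
  intro p mp hp ip sp p0 _
  obtain ⟨ψ, hψ, sψ⟩ := supp_prim hR ip sp p0
  have h1 := first_var hϵ hg hu (R := R) (measurable_const (a := (0:ℝ))) mp
    MemLp.zero' hp isPrim_zero isPrim_zero hψ (fun _ _ => rfl) sψ
  simp only [mul_zero, integral_zero, zero_add] at h1
  have s1 : Supp R (fun x => Pb g (u.A x) (u.B x) * ψ x) := fun x hx => by simp [sψ x hx]
  have s2 : Supp R (fun x => H x * p x) := fun x hx => by simp [sp x hx]
  have h2 := hψ.ibp hH (-R) R
  rw [sψ R (le_abs_self R), sψ (-R) (by rw [abs_neg]; exact le_abs_self R)] at h2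
  have i2 : Integrable (fun x => H x * p x) := by
    have := memLp_loc hH.continuous R
    have h3 : IntegrableOn (fun x => H x * p x) (Set.Ioo (-R) R) :=
      this.integrable_mul (hp.restrict _)
    rw [integrableOn_iff_integrable_of_support_subset] at h3
    · exact h3
    · intro x hx
      by_contra hm
      refine hx (s2 x ?_)
      by_contra! hlt
      exact hm (abs_lt.1 hlt)
  have i1 : Integrable (fun x => u.h x * p x) := mh.integrable_mul hp
  simp only [Pi.sub_apply, sub_mul]
  rw [integral_sub i1 i2, s2.int]
  rw [s1.int] at h1
  have e1 : ∫ x in (-R)..R, Pb g (u.A x) (u.B x) * ψ x = ∫ x in (-R)..R, ψ x * Pb g (u.A x) (u.B x) := by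
    simp only [mul_comm]
  have e2 : ∫ x in (-R)..R, p x * H x = ∫ x in (-R)..R, H x * p x := by
    simp only [mul_comm]
  rw [e1, h2, e2] at h1
  linarith

lemma el_A {ϵ g : ℝ} (hϵ : 0 < ϵ) (hg : 1 < g) {u : Pth} (hu : isMin ϵ g u) {G G1 : ℝ → ℝ}
    (hG1 : IsPrim G1 (fun x => Pa g (u.A x) (u.B x))) (hG : IsPrim G G1) :
    ∃ a b : ℝ, ∀ᵐ x, ϵ * u.f x + G x = a + b * x := by
  obtain ⟨mf, mh, -⟩ := basics hϵ hg (C := (En ϵ g u Set.univ).toReal) ENNReal.toReal_nonneg u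
    (by rw [ENNReal.ofReal_toReal hu.2.1.ne])
  refine glob fun R hR => dbr hR ((u.mf.const_mul ϵ).add hG.continuous.measurable)
    (((mf.const_mul ϵ).restrict _).add (memLp_loc hG.continuous R)) ?_
  intro q mq hq iq sq q0 q1
  obtain ⟨φ1, hφ1, sφ1⟩ := supp_prim hR iq sq q0
  have hRe : ∀ F, Supp R F → F R = 0 ∧ F (-R) = 0 := fun F hF =>
    ⟨hF R (le_abs_self R), hF (-R) (by rw [abs_neg]; exact le_abs_self R)⟩
  have i0 : ∫ x, φ1 x = 0 := by
    have hid : IsPrim (fun x => x) (fun _ => 1) :=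
      isPrim_of_hasDerivAt (fun x => hasDerivAt_id x) continuous_const
    have h := hid.ibp hφ1 (-R) R
    have s : Supp R (fun x => x * q x) := fun x hx => by simp [sq x hx]
    rw [← s.int, q1, (hRe _ sφ1).1, (hRe _ sφ1).2] at h
    simp only [one_mul] at h
    rw [sφ1.int]
    linarith
  obtain ⟨φ, hφ, sφ⟩ := supp_prim hR (sφ1.integrable hφ1.continuous) sφ1 i0
  have h1 := first_var hϵ hg hu (R := R) mq (measurable_const (a := (0:ℝ)))
    hq MemLp.zero' hφ1 hφ isPrim_zero sφ (fun _ _ => rfl)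
  simp only [mul_zero, integral_zero, add_zero] at h1
  have s1 : Supp R (fun x => Pa g (u.A x) (u.B x) * φ x) := fun x hx => by simp [sφ x hx]
  have s2 : Supp R (fun x => G x * q x) := fun x hx => by simp [sq x hx]
  have h2 := hφ.ibp hG1 (-R) R
  have h3 := hφ1.ibp hG (-R) R
  rw [(hRe _ sφ).1, (hRe _ sφ).2] at h2
  rw [(hRe _ sφ1).1, (hRe _ sφ1).2] at h3
  have i2 : Integrable (fun x => G x * q x) := by
    have := memLp_loc hG.continuous R
    have h3 : IntegrableOn (fun x => G x * q x) (Set.Ioo (-R) R) :=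
      this.integrable_mul (hq.restrict _)
    rw [integrableOn_iff_integrable_of_support_subset] at h3
    · exact h3
    · intro x hx
      by_contra hm
      refine hx (s2 x ?_)
      by_contra! hlt
      exact hm (abs_lt.1 hlt)
  have i1 : Integrable (fun x => ϵ * (u.f x * q x)) := (mf.integrable_mul hq).const_mul ϵ
  simp only [Pi.add_apply, add_mul, mul_assoc]
  rw [integral_add i1 i2, s2.int]
  rw [s1.int] at h1
  have e1 : ∫ x in (-R)..R, Pa g (u.A x) (u.B x) * φ x = ∫ x in (-R)..R, φ x * Pa g (u.A x) (u.B x) := by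
    simp only [mul_comm]
  have e2 : ∫ x in (-R)..R, q x * G x = ∫ x in (-R)..R, G x * q x := by
    simp only [mul_comm]
  rw [e1, h2, h3, e2] at h1
  linarith

lemma cd_succ {F f : ℝ → ℝ} {n : ℕ} (h : ∀ x, HasDerivAt F (f x) x) (hf : ContDiff ℝ n f) :
    ContDiff ℝ (n + 1 : ℕ) F := by
  have : deriv F = f := funext fun x => (h x).deriv
  push_cast
  rw [contDiff_succ_iff_deriv]
  exact ⟨fun x => (h x).differentiableAt, by simp, by rw [this]; exact hf⟩

lemma regular {ϵ g : ℝ} (hϵ : 0 < ϵ) (hg : 1 < g) {u : Pth} (hu : isMin ϵ g u) :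
    ContDiff ℝ (⊤ : ℕ∞) u.A ∧ ContDiff ℝ (⊤ : ℕ∞) u.B := by
  have cA := u.cA
  have cB := u.cB
  have cPa : Continuous (fun x => Pa g (u.A x) (u.B x)) := by unfold Pa; fun_prop
  have cPb : Continuous (fun x => Pb g (u.A x) (u.B x)) := by unfold Pb; fun_prop
  obtain ⟨H, hH⟩ := exists_prim cPb
  obtain ⟨G1, hG1⟩ := exists_prim cPa
  obtain ⟨G, hG⟩ := exists_prim hG1.continuous
  obtain ⟨a, b, hab⟩ := el_A hϵ hg hu hG1 hG
  obtain ⟨c, d, hcd⟩ := el_B hϵ hg hu hH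
  have cG := hG.continuous
  have cH := hH.continuous
  have pA1 : IsPrim u.A1 (fun x => (a + b * x - G x) / ϵ) := by
    refine u.pA1.congr_ae ?_
    filter_upwards [hab] with x hx
    rw [eq_div_iff hϵ.ne']; linarith
  have pB : IsPrim u.B (fun x => H x + (c + d * x)) := by
    refine u.pB.congr_ae ?_
    filter_upwards [hcd] with x hx
    linarith
  have dA1 := pA1.hasDerivAt (by fun_prop)
  have dA := u.pA.hasDerivAt u.cA1
  have dB := pB.hasDerivAt (by fun_prop)
  have dG := hG.hasDerivAt hG1.continuous
  have dG1 := hG1.hasDerivAt cPa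
  have dH := hH.hasDerivAt cPb
  have main : ∀ n : ℕ, ContDiff ℝ n u.A ∧ ContDiff ℝ n u.B := by
    intro n
    induction n with
    | zero => exact ⟨contDiff_zero.2 cA, contDiff_zero.2 cB⟩
    | succ n ih =>
      obtain ⟨hA, hB⟩ := ih
      have k1 : ContDiff ℝ n (fun x => Pa g (u.A x) (u.B x)) := by unfold Pa; fun_prop
      have k2 : ContDiff ℝ n (fun x => Pb g (u.A x) (u.B x)) := by unfold Pb; fun_prop
      have le : ((n:ℕ) : WithTop ℕ∞) ≤ ((n + 1 : ℕ) : WithTop ℕ∞) := by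
        exact_mod_cast Nat.le_succ n
      have k3 := (cd_succ dH k2).of_le le
      have k4 := (cd_succ dG1 k1).of_le le
      have k5 := (cd_succ dG k4).of_le le
      have k6 : ContDiff ℝ n u.A1 := by
        refine (cd_succ dA1 ?_).of_le le
        fun_prop
      refine ⟨cd_succ dA k6, cd_succ dB ?_⟩
      fun_prop
  exact ⟨contDiff_infty.2 fun n => (main n).1, contDiff_infty.2 fun n => (main n).2⟩

def Pth.flip (u : Pth) : Pth where
  A x := (-1) * u.A x
  A1 x := (-1) * u.A1 x
  f x := (-1) * u.f x
  B := u.B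
  h := u.h
  mf := u.mf.const_mul _
  mh := u.mh
  pA1 := u.pA1.const_mul _
  pA := u.pA.const_mul _
  pB := u.pB

lemma flip_isMin {ϵ g : ℝ} {u : Pth} (h : isMin ϵ g u) : isMin ϵ g u.flip := by
  have e1 : phi u.flip = phi u := by funext x; simp [phi, Pth.flip]
  have e2 : dens ϵ g u.flip = dens ϵ g u := by funext x; simp [dens, Pth.flip, Pfun]
  unfold isMin inY En
  rw [e1, e2]
  exact h

lemma sign_bot {u : Pth} (h : inY u) :
    (∀ᶠ x in atBot, 0 < u.A x) ∨ (∀ᶠ x in atBot, u.A x < 0) := by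
  obtain ⟨N, hN⟩ := eventually_atBot.1 h.1
  have hne : ∀ x ≤ N, u.A x ≠ 0 := by
    intro x hx h0
    have := hN x hx
    unfold phi at this
    rw [h0] at this
    nlinarith [sq_nonneg (u.B x)]
  rcases lt_or_gt_of_ne (hne N le_rfl) with h1 | h1
  · right
    filter_upwards [eventually_le_atBot N] with x hx
    by_contra! hge
    obtain ⟨y, hy, hy0⟩ := intermediate_value_Icc' hx u.cA.continuousOn ⟨h1.le, hge⟩
    exact hne y hy.2 hy0
  · left
    filter_upwards [eventually_le_atBot N] with x hx
    by_contra! hge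
    obtain ⟨y, hy, hy0⟩ := intermediate_value_Icc hx u.cA.continuousOn ⟨hge, h1.le⟩
    exact hne y hy.2 hy0

lemma exists_good {ϵ g : ℝ} (hϵ : 0 < ϵ) (hg : 1 < g) :
    ∃ u, isMin ϵ g u ∧ (∀ x, 0 ≤ u.B x) ∧ ∀ᶠ x in atBot, 0 < u.A x := by
  obtain ⟨v, hv⟩ := exists_min hϵ hg
  have hm : isMin ϵ g v.absB := absB_isMin hv
  rcases sign_bot hm.1 with h | h
  · exact ⟨v.absB, hm, fun x => abs_nonneg _, h⟩
  · refine ⟨v.absB.flip, flip_isMin hm, fun x => abs_nonneg _, ?_⟩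
    filter_upwards [h] with x hx
    change 0 < (-1) * v.absB.A x
    linarith


lemma pm_one {σ : ℝ} (h : σ ^ 2 = 1) : σ = 1 ∨ σ = -1 := by
  have h1 : (σ - 1) * (σ + 1) = 0 := by linear_combination h
  rcases mul_eq_zero.1 h1 with h2 | h2
  · left; linarith
  · right; linarith

lemma lim_bot {ϵ g : ℝ} (hϵ : 0 < ϵ) (hg : 1 < g) {u : Pth} (hu : isMin ϵ g u)
    (hA : ∀ᶠ x in atBot, 0 < u.A x) :
    Tendsto (fun x => (u.A x, u.B x)) atBot (nhds ((1 : ℝ), (0 : ℝ))) := by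
  have key : ∀ ε > 0, ∀ᶠ x in atBot, |u.A x - 1| < ε ∧ |u.B x| < ε := by
    intro ε hε
    obtain ⟨η, h0, h1, h2⟩ : ∃ η : ℝ, 0 < η ∧ η ≤ 1/4 ∧ η < ε :=
      ⟨min (1/4) (ε/2), by positivity, min_le_left _ _, (min_le_right _ _).trans_lt (by linarith)⟩
    filter_upwards [tail_near hϵ hg u hu.2.1 tendsto_abs_atBot_atTop h0, hu.1.1, hA]
      with x hx hphi hpos
    rcases hx with ⟨σ, q1, q2, q3, q4⟩ | h
    · rcases (pm_one q1) with h | h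
      · rw [h] at q2
        exact ⟨q2.trans_lt h2, q4.trans_lt h2⟩
      · rw [h] at q2
        have := (abs_le.1 q2).2
        linarith
    · exact absurd hphi (not_lt.2 (h.phi h1).le)
  refine Tendsto.prodMk_nhds ?_ ?_
  · refine Metric.tendsto_nhds.2 fun ε hε => (key ε hε).mono fun x hx => hx.1
  · refine Metric.tendsto_nhds.2 fun ε hε => (key ε hε).mono fun x hx => ?_
    rw [Real.dist_eq, sub_zero]; exact hx.2

lemma lim_top {ϵ g : ℝ} (hϵ : 0 < ϵ) (hg : 1 < g) {u : Pth} (hu : isMin ϵ g u)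
    (hB : ∀ x, 0 ≤ u.B x) :
    Tendsto (fun x => (u.A x, u.B x)) atTop (nhds ((0 : ℝ), (1 : ℝ))) := by
  have key : ∀ ε > 0, ∀ᶠ x in atTop, |u.A x| < ε ∧ |u.B x - 1| < ε := by
    intro ε hε
    obtain ⟨η, h0, h1, h2⟩ : ∃ η : ℝ, 0 < η ∧ η ≤ 1/4 ∧ η < ε :=
      ⟨min (1/4) (ε/2), by positivity, min_le_left _ _, (min_le_right _ _).trans_lt (by linarith)⟩
    filter_upwards [tail_near hϵ hg u hu.2.1 tendsto_abs_atTop_atTop h0, hu.1.2]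
      with x hx hphi
    rcases hx with h | ⟨σ, q1, q2, q3, q4⟩
    · exact absurd hphi (not_lt.2 (h.phi h1).le)
    · rcases (pm_one q1) with h | h
      · rw [h] at q4
        exact ⟨q2.trans_lt h2, q4.trans_lt h2⟩
      · rw [h] at q4
        have := (abs_le.1 q4).2
        linarith [hB x]
  refine Tendsto.prodMk_nhds ?_ ?_
  · refine Metric.tendsto_nhds.2 fun ε hε => (key ε hε).mono fun x hx => ?_
    rw [Real.dist_eq, sub_zero]; exact hx.1
  · refine Metric.tendsto_nhds.2 fun ε hε => (key ε hε).mono fun x hx => hx.2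

lemma J_eq {ϵ g : ℝ} (u : Pth) : Jfun ϵ g u.A u.B = En ϵ g u Set.univ := by
  unfold Jfun En
  rw [Measure.restrict_univ]
  have hd : deriv u.A = u.A1 := funext fun x => (u.pA.hasDerivAt u.cA1 x).deriv
  have h2 : iteratedDeriv 2 u.A = deriv u.A1 := by
    rw [iteratedDeriv_succ, iteratedDeriv_one, hd]
  refine lintegral_congr_ae ?_
  filter_upwards [u.pA1.ae_hasDerivAt, u.pB.ae_hasDerivAt] with x h3 h4
  rw [h2, h3.deriv, h4.deriv]
  rfl

lemma memX_pth {A B : ℝ → ℝ} (h : memX A B) : ∃ w : Pth, inY w ∧ w.A = A ∧ w.B = B := by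
  obtain ⟨hA, hB, h1, h2⟩ := h
  have hA2 : ContDiff ℝ (1 + 1) A := by simpa [one_add_one_eq_two] using hA
  obtain ⟨dA, -, hA1⟩ := contDiff_succ_iff_deriv.1 hA2
  obtain ⟨dA1, c2⟩ := contDiff_one_iff_deriv.1 hA1
  obtain ⟨dB, cB⟩ := contDiff_one_iff_deriv.1 hB
  refine ⟨{ A := A, A1 := deriv A, f := deriv (deriv A), B := B, h := deriv B
            mf := c2.measurable, mh := cB.measurable
            pA1 := isPrim_of_hasDerivAt (fun x => (dA1 x).hasDerivAt) c2
            pA := isPrim_of_hasDerivAt (fun x => (dA x).hasDerivAt) hA1.continuous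
            pB := isPrim_of_hasDerivAt (fun x => (dB x).hasDerivAt) cB }, ⟨?_, ?_⟩, rfl, rfl⟩
  · have a := h1.fst_nhds
    have b := h1.snd_nhds
    have : Tendsto (fun x => B x ^ 2 - A x ^ 2) atBot (nhds (0 ^ 2 - 1 ^ 2)) :=
      (b.pow 2).sub (a.pow 2)
    exact this.eventually (gt_mem_nhds (by norm_num))
  · have a := h2.fst_nhds
    have b := h2.snd_nhds
    have : Tendsto (fun x => B x ^ 2 - A x ^ 2) atTop (nhds (1 ^ 2 - 0 ^ 2)) :=
      (b.pow 2).sub (a.pow 2)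
    exact this.eventually (lt_mem_nhds (by norm_num))

/-- For every `ϵ > 0`, `g > 1` there is a smooth pair `(A,B)`
with the heteroclinic limits, `B ≥ 0`, minimizing `J_{ϵ,g}` over `X`. -/
theorem minimizer_exists (ϵ g : ℝ) (hϵ : 0 < ϵ) (hg : 1 < g) :
    ∃ A B : ℝ → ℝ, ContDiff ℝ (⊤ : ℕ∞) A ∧ ContDiff ℝ (⊤ : ℕ∞) B ∧
      Tendsto (fun x => (A x, B x)) atBot (nhds ((1 : ℝ), (0 : ℝ))) ∧
      Tendsto (fun x => (A x, B x)) atTop (nhds ((0 : ℝ), (1 : ℝ))) ∧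
      (∀ x : ℝ, 0 ≤ B x) ∧
      (∀ A' B' : ℝ → ℝ, memX A' B' → Jfun ϵ g A B ≤ Jfun ϵ g A' B') := by
  obtain ⟨u, hu, hB, hA⟩ := exists_good hϵ hg
  obtain ⟨sA, sB⟩ := regular hϵ hg hu
  refine ⟨u.A, u.B, sA, sB, lim_bot hϵ hg hu hA, lim_top hϵ hg hu hB, hB, ?_⟩
  intro A' B' h
  obtain ⟨w, hw, rfl, rfl⟩ := memX_pth h
  rw [J_eq, J_eq]
  exact hu.2.2 w hw
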